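/- In the discharging of H defined by rules R1–R5 applied to the initial charge (every j-face charged with weight j), every minor j-face f of H with j ≥ 9 has final weight w(f) ≥ 10/3. -/

import Mathlib

open scoped Classical

noncomputable section

/-- A plane embedding (drawing) of a simple graph: vertices are mapped to distinct
points of the plane, every edge is drawn as a simple arc joining the points of its two
endvertices, arcs contain no vertex points other than their endpoints, and two distinct
arcs meet only in common endpoints. -/
structure PlaneEmbedding {V : Type*} (G : SimpleGraph V) where
  pos : V → ℝ × ℝ
  arc : V → V → Set (ℝ × ℝ)
  pos_injective : Function.Injective pos
  arc_symm : ∀ u v, arc u v = arc v u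
  arc_curve : ∀ u v, G.Adj u v → ∃ γ : ℝ → ℝ × ℝ,
      ContinuousOn γ (Set.Icc 0 1) ∧ Set.InjOn γ (Set.Icc 0 1) ∧
      γ 0 = pos u ∧ γ 1 = pos v ∧ γ '' Set.Icc 0 1 = arc u v
  arc_vertex : ∀ u v, G.Adj u v → ∀ w, pos w ∈ arc u v → w = u ∨ w = v
  arc_inter : ∀ u v x y, G.Adj u v → G.Adj x y → s(u, v) ≠ s(x, y) →
      arc u v ∩ arc x y ⊆ Set.range pos

/-- A graph is planar if it admits a plane embedding. -/
def SimpleGraph.IsPlanar {V : Type*} (G : SimpleGraph V) : Prop :=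
  Nonempty (PlaneEmbedding G)

/-- A graph is 3-connected if it has at least four vertices and deleting any set of at
most two vertices leaves a connected graph. -/
def ThreeConnected {V : Type*} [Fintype V] (G : SimpleGraph V) : Prop :=
  4 ≤ Fintype.card V ∧
    ∀ S : Finset V, S.card ≤ 2 → (G.induce ((↑S : Set V)ᶜ)).Connected

/-- `S` is a separator of `G`: deleting it leaves a disconnected graph. -/
def IsSeparator {V : Type*} [Fintype V] (G : SimpleGraph V) (S : Finset V) : Prop :=
  ¬ (G.induce ((↑S : Set V)ᶜ)).Connected

/-- A separator `S` is trivial if some component of `G - S` is a single vertex, i.e.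
some vertex outside `S` has all of its neighbours inside `S`. -/
def TrivialSeparator {V : Type*} [Fintype V] (G : SimpleGraph V) (S : Finset V) : Prop :=
  ∃ v : V, v ∉ S ∧ ∀ w : V, G.Adj v w → w ∈ S

/-- A graph is essentially 4-connected if it is 3-connected and every 3-separator is
trivial. -/
def EssentiallyFourConnected {V : Type*} [Fintype V] (G : SimpleGraph V) : Prop :=
  ThreeConnected G ∧
    ∀ S : Finset V, S.card = 3 → IsSeparator G S → TrivialSeparator G S

/-- A cycle `C` of `G` is isolating if every component of `G - V(C)` is a single vertex
of degree 3 in `G`, i.e. every vertex not on `C` has degree 3 in `G` and all of its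
neighbours on `C`. -/
def IsIsolating {V : Type*} [Fintype V] (G : SimpleGraph V) {x : V} (C : G.Walk x x) : Prop :=
  ∀ v : V, v ∉ C.support →
    (Finset.univ.filter fun w => G.Adj v w).card = 3 ∧ ∀ w : V, G.Adj v w → w ∈ C.support

/-- `C` is a longest isolating cycle of `G`. -/
def IsLongestIsolatingCycle {V : Type*} [Fintype V] (G : SimpleGraph V) {x : V}
    (C : G.Walk x x) : Prop :=
  C.IsCycle ∧ IsIsolating G C ∧
    ∀ (y : V) (C' : G.Walk y y), C'.IsCycle → IsIsolating G C' → C'.length ≤ C.length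

section PlaneSetup

variable {V : Type*} [Fintype V] {G : SimpleGraph V}

/-- The chords of the cycle `C`: edges of `G` not on `C` joining two vertices of `C`. -/
def chordSet {x : V} (C : G.Walk x x) : Set (Sym2 V) :=
  {e | e ∈ G.edgeSet ∧ e ∉ C.edges ∧ ∀ v ∈ e, v ∈ C.support}

/-- The plane graph `H` obtained from `G` by deleting all chords of `C`. -/
def Hgraph {x : V} (C : G.Walk x x) : SimpleGraph V :=
  G.deleteEdges (chordSet C)

/-- The arc drawing an edge, as a function of the unordered edge. -/
def arcSet (emb : PlaneEmbedding G) : Sym2 V → Set (ℝ × ℝ) :=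
  Sym2.lift ⟨emb.arc, emb.arc_symm⟩

/-- The point set of the drawing of the subgraph of `H'` induced on the vertex set `s`
(in the embedding `emb` of `G`). -/
def drawingOn (emb : PlaneEmbedding G) (H' : SimpleGraph V) (s : Set V) : Set (ℝ × ℝ) :=
  emb.pos '' s ∪
    ⋃ (u : V) (v : V) (_ : H'.Adj u v) (_ : u ∈ s) (_ : v ∈ s), emb.arc u v

/-- The drawing of `H`. -/
def drawingH (emb : PlaneEmbedding G) {x : V} (C : G.Walk x x) : Set (ℝ × ℝ) :=
  drawingOn emb (Hgraph C) Set.univ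

/-- `f` is a face of the drawing `D`: a connected component of its complement. -/
def IsFaceOf (D : Set (ℝ × ℝ)) (f : Set (ℝ × ℝ)) : Prop :=
  ∃ z : ℝ × ℝ, z ∉ D ∧ f = connectedComponentIn Dᶜ z

/-- The drawing of the cycle `C`. -/
def drawC (emb : PlaneEmbedding G) {x : V} (C : G.Walk x x) : Set (ℝ × ℝ) :=
  ⋃ e ∈ C.edges, arcSet emb e

/-- The open region strictly inside the closed curve given by `C`: the points off the
curve whose connected component in the complement is bounded. -/
def insideC (emb : PlaneEmbedding G) {x : V} (C : G.Walk x x) : Set (ℝ × ℝ) :=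
  {z | z ∉ drawC emb C ∧ Bornology.IsBounded (connectedComponentIn (drawC emb C)ᶜ z)}

/-- The vertices of `G` strictly inside `C`. -/
def Vminus (emb : PlaneEmbedding G) {x : V} (C : G.Walk x x) : Finset V :=
  Finset.univ.filter fun v => v ∉ C.support ∧ emb.pos v ∈ insideC emb C

/-- The vertices of `G` strictly outside `C`:  `V⁺ = V - V(C) - V⁻`. -/
def Vplus (emb : PlaneEmbedding G) {x : V} (C : G.Walk x x) : Finset V :=
  Finset.univ.filter fun v => v ∉ C.support ∧ v ∉ Vminus emb C

/-- A face `f` is incident with the vertex `v`. -/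
def incVertex (emb : PlaneEmbedding G) (f : Set (ℝ × ℝ)) (v : V) : Prop :=
  emb.pos v ∈ closure f

/-- A face `f` is incident with the edge `e` (the arc of `e` lies on the boundary). -/
def incEdge (emb : PlaneEmbedding G) (f : Set (ℝ × ℝ)) (e : Sym2 V) : Prop :=
  arcSet emb e ⊆ closure f

/-- A minor face of the drawing `D`: a face incident with exactly one vertex of
`V⁻ ∪ V⁺`. -/
def MinorFaceOf (emb : PlaneEmbedding G) {x : V} (C : G.Walk x x)
    (D : Set (ℝ × ℝ)) (f : Set (ℝ × ℝ)) : Prop :=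
  IsFaceOf D f ∧ ∃! v : V, v ∈ Vminus emb C ∪ Vplus emb C ∧ incVertex emb f v

/-- `M⁻`: the minor faces of `H⁻ = H - V⁺`. -/
def Mminus (emb : PlaneEmbedding G) {x : V} (C : G.Walk x x) : Set (Set (ℝ × ℝ)) :=
  {f | MinorFaceOf emb C (drawingOn emb (Hgraph C) ((↑(Vplus emb C) : Set V)ᶜ)) f}

/-- `M⁺`: the minor faces of `H⁺ = H - V⁻`. -/
def Mplus (emb : PlaneEmbedding G) {x : V} (C : G.Walk x x) : Set (Set (ℝ × ℝ)) :=
  {f | MinorFaceOf emb C (drawingOn emb (Hgraph C) ((↑(Vminus emb C) : Set V)ᶜ)) f}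

/-- A minor face of `H`. -/
def MinorFaceH (emb : PlaneEmbedding G) {x : V} (C : G.Walk x x) (f : Set (ℝ × ℝ)) : Prop :=
  MinorFaceOf emb C (drawingH emb C) f

/-- A major face of `H`: a face of `H` that is not minor. -/
def MajorFaceH (emb : PlaneEmbedding G) {x : V} (C : G.Walk x x) (f : Set (ℝ × ℝ)) : Prop :=
  IsFaceOf (drawingH emb C) f ∧ ¬ MinorFaceH emb C f

/-- The number of `C`-edges of a face `f` (so `f` is a `j`-face when this equals `j`). -/
def numCEdges (emb : PlaneEmbedding G) {x : V} (C : G.Walk x x) (f : Set (ℝ × ℝ)) : ℕ :=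
  (C.edges.toFinset.filter fun e => incEdge emb f e).card

/-- `m_{f,f'}`: the number of common `C`-edges of the faces `f` and `f'`. -/
def mEdges (emb : PlaneEmbedding G) {x : V} (C : G.Walk x x)
    (f f' : Set (ℝ × ℝ)) : ℕ :=
  (C.edges.toFinset.filter fun e => incEdge emb f e ∧ incEdge emb f' e).card

/-- `f'` is opposite to `f` (with respect to some `C`-edge incident with both). -/
def OppositeFaces (emb : PlaneEmbedding G) {x : V} (C : G.Walk x x)
    (f f' : Set (ℝ × ℝ)) : Prop :=
  f ≠ f' ∧ ∃ e ∈ C.edges, incEdge emb f e ∧ incEdge emb f' e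

/-- `e` is the middle `C`-edge of the face `f` (for a 3-face, the `C`-edge sharing an
endvertex with every other `C`-edge of `f`). -/
def IsMiddleCEdge (emb : PlaneEmbedding G) {x : V} (C : G.Walk x x)
    (f : Set (ℝ × ℝ)) (e : Sym2 V) : Prop :=
  e ∈ C.edges ∧ incEdge emb f e ∧
    ∀ e' ∈ C.edges, incEdge emb f e' → e' ≠ e → ∃ v : V, v ∈ e ∧ v ∈ e'

/-- The total weight sent from the face `f` to the face `f'` by the discharging rules
R1–R5 (each rule applied exactly once). -/
def sendWeight (emb : PlaneEmbedding G) {x : V} (C : G.Walk x x)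
    (f f' : Set (ℝ × ℝ)) : ℚ :=
  -- R1: a major face sends `m_{f,f'}` to every opposite minor face
  (if MajorFaceH emb C f ∧ MinorFaceH emb C f' ∧ OppositeFaces emb C f f'
    then (mEdges emb C f f' : ℚ) else 0)
  -- R2: a minor face sends `(2/3)·m_{f,f'}` to every opposite minor 2-face
  + (if MinorFaceH emb C f ∧ MinorFaceH emb C f' ∧ numCEdges emb C f' = 2 ∧
        OppositeFaces emb C f f'
    then 2 / 3 * (mEdges emb C f f' : ℚ) else 0)
  -- R3: a minor face sends 1 to every minor 3-face opposite with respect to its middle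
  -- `C`-edge
  + (if MinorFaceH emb C f ∧ MinorFaceH emb C f' ∧ numCEdges emb C f' = 3 ∧ f ≠ f' ∧
        (∃ e : Sym2 V, IsMiddleCEdge emb C f' e ∧ incEdge emb f e)
    then 1 else 0)
  -- R4
  + (if MinorFaceH emb C f ∧ 4 ≤ numCEdges emb C f ∧ MinorFaceH emb C f' ∧
        numCEdges emb C f' = 4 ∧ OppositeFaces emb C f' f ∧ mEdges emb C f' f = 2 ∧
        (∃ f₂ : Set (ℝ × ℝ), MinorFaceH emb C f₂ ∧
          (numCEdges emb C f₂ = 2 ∨ numCEdges emb C f₂ = 3) ∧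
          OppositeFaces emb C f' f₂ ∧ mEdges emb C f' f₂ = 2)
    then 2 / 3 else 0)
  -- R5
  + (if MinorFaceH emb C f ∧ 4 ≤ numCEdges emb C f ∧ MinorFaceH emb C f' ∧
        numCEdges emb C f' = 5 ∧ OppositeFaces emb C f' f ∧ mEdges emb C f' f = 2 ∧
        (∃ g₁ g₂ : Set (ℝ × ℝ), g₁ ≠ g₂ ∧
          MinorFaceH emb C g₁ ∧ numCEdges emb C g₁ = 2 ∧ OppositeFaces emb C f' g₁ ∧
          MinorFaceH emb C g₂ ∧ numCEdges emb C g₂ = 2 ∧ OppositeFaces emb C f' g₂)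
    then 1 / 3 else 0)

/-- The final weight of a face `f` after discharging: the initial charge `j` of a
`j`-face, minus everything sent, plus everything received. -/
def wFace (emb : PlaneEmbedding G) {x : V} (C : G.Walk x x) (f : Set (ℝ × ℝ)) : ℚ :=
  (numCEdges emb C f : ℚ) - (∑ᶠ f' : Set (ℝ × ℝ), sendWeight emb C f f')
    + ∑ᶠ f' : Set (ℝ × ℝ), sendWeight emb C f' f

end PlaneSetup

/-- `a` and `b` lie in a common connected set avoiding `X`. -/
def LinkedOff {E : Type*} [TopologicalSpace E] (X : Set E) (a b : E) : Prop :=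
  ∃ t : Set E, IsPreconnected t ∧ t ⊆ Xᶜ ∧ a ∈ t ∧ b ∈ t

namespace LinkedOff

variable {E : Type*} [TopologicalSpace E] {X Y : Set E} {a b c : E}

lemma notMem_left (h : LinkedOff X a b) : a ∉ X := by
  obtain ⟨t, -, h1, h2, -⟩ := h
  exact h1 h2

lemma symm (h : LinkedOff X a b) : LinkedOff X b a := by
  obtain ⟨t, h0, h1, h2, h3⟩ := h
  exact ⟨t, h0, h1, h3, h2⟩

lemma notMem_right (h : LinkedOff X a b) : b ∉ X := h.symm.notMem_left

lemma trans (h : LinkedOff X a b) (h' : LinkedOff X b c) : LinkedOff X a c := by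
  obtain ⟨t, h0, h1, h2, h3⟩ := h
  obtain ⟨t', h0', h1', h2', h3'⟩ := h'
  exact ⟨t ∪ t', h0.union b h3 h2' h0', Set.union_subset h1 h1', Or.inl h2, Or.inr h3'⟩

lemma mono (h : LinkedOff X a b) (hYX : Y ⊆ X) : LinkedOff Y a b := by
  obtain ⟨t, h0, h1, h2, h3⟩ := h
  exact ⟨t, h0, h1.trans (Set.compl_subset_compl.2 hYX), h2, h3⟩

lemma iff_mem_connectedComponentIn : LinkedOff X a b ↔ b ∈ connectedComponentIn Xᶜ a := by
  constructor
  · rintro ⟨t, h0, h1, h2, h3⟩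
    exact h0.subset_connectedComponentIn h2 h1 h3
  · intro h
    have ha : a ∈ Xᶜ := by
      by_contra ha
      simp [connectedComponentIn_eq_empty ha] at h
    exact ⟨_, isPreconnected_connectedComponentIn, connectedComponentIn_subset _ _,
      mem_connectedComponentIn ha, h⟩

lemma image {F : Type*} [TopologicalSpace F] (e : E ≃ₜ F) (h : LinkedOff X a b) :
    LinkedOff (e '' X) (e a) (e b) := by
  obtain ⟨t, h0, h1, h2, h3⟩ := h
  refine ⟨e '' t, h0.image _ e.continuous.continuousOn, ?_, ⟨a, h2, rfl⟩, ⟨b, h3, rfl⟩⟩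
  rw [← Set.image_compl_eq e.bijective]
  exact Set.image_mono h1

lemma image_iff {F : Type*} [TopologicalSpace F] (e : E ≃ₜ F) :
    LinkedOff (e '' X) (e a) (e b) ↔ LinkedOff X a b := by
  refine ⟨fun h => ?_, image e⟩
  simpa [Set.image_image] using h.image e.symm

end LinkedOff

/-- `φ` has a continuous logarithm on `X`. -/
def HasLogOn (X : Set ℂ) (φ : ℂ → ℂ) : Prop :=
  ∃ g : ℂ → ℂ, ContinuousOn g X ∧ ∀ z ∈ X, Complex.exp (g z) = φ z

namespace HasLogOn

variable {X Y : Set ℂ} {φ ψ : ℂ → ℂ}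

lemma mono (h : HasLogOn X φ) (hYX : Y ⊆ X) : HasLogOn Y φ := by
  obtain ⟨g, h1, h2⟩ := h
  exact ⟨g, h1.mono hYX, fun z hz => h2 z (hYX hz)⟩

lemma congr (h : HasLogOn X φ) (h' : ∀ z ∈ X, φ z = ψ z) : HasLogOn X ψ := by
  obtain ⟨g, h1, h2⟩ := h
  exact ⟨g, h1, fun z hz => (h2 z hz).trans (h' z hz)⟩

lemma mul (h : HasLogOn X φ) (h' : HasLogOn X ψ) : HasLogOn X (fun z => φ z * ψ z) := by
  obtain ⟨g, h1, h2⟩ := h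
  obtain ⟨g', h1', h2'⟩ := h'
  exact ⟨fun z => g z + g' z, h1.add h1', fun z hz => by
    rw [Complex.exp_add, h2 z hz, h2' z hz]⟩

lemma zpow (h : HasLogOn X φ) (n : ℤ) : HasLogOn X (fun z => φ z ^ n) := by
  obtain ⟨g, h1, h2⟩ := h
  exact ⟨fun z => n * g z, continuousOn_const.mul h1, fun z hz => by
    rw [Complex.exp_int_mul, h2 z hz]⟩

end HasLogOn

lemma exists_continuous_log {E : Type*} [NormedAddCommGroup E] [NormedSpace ℝ E] {φ : E → ℂ}
    (hφ : Continuous φ) (h0 : ∀ z, φ z ≠ 0) :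
    ∃ L : E → ℂ, Continuous L ∧ ∀ z, Complex.exp (L z) = φ z := by
  have hsc : IsSimplyConnected (Set.univ : Set E) := by
    have : ContractibleSpace (Set.univ : Set E) :=
      convex_univ.contractibleSpace Set.univ_nonempty
    exact SimplyConnectedSpace.ofContractible _
  obtain ⟨f, hf, hf'⟩ := Complex.exists_continuousOn_eqOn_exp_comp hsc isOpen_univ
    hφ.continuousOn (by simpa using h0)
  exact ⟨f, continuousOn_univ.1 hf, fun z => hf' trivial⟩

/-- A continuous function whose exponential is constantly one on a preconnected set is constant. -/
lemma exists_int_of_exp_eq_one {E : Type*} [TopologicalSpace E] {X : Set E} {g : E → ℂ}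
    (hX : IsPreconnected X) (hg : ContinuousOn g X) (h1 : ∀ z ∈ X, Complex.exp (g z) = 1) :
    ∃ n : ℤ, ∀ z ∈ X, g z = n * (2 * Real.pi * Complex.I) := by
  rcases X.eq_empty_or_nonempty with rfl | ⟨x, hx⟩
  · exact ⟨0, by simp⟩
  obtain ⟨n, hn⟩ := Complex.exp_eq_one_iff.1 (h1 x hx)
  refine ⟨n, fun z hz => ?_⟩
  rw [← hn]
  refine Complex.isCoveringMap_exp.constOn_of_comp hX hg (fun a ha b hb => ?_) hz hx
  simp [h1 a ha, h1 b hb]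

lemma int_eq_zero_of_eq_zpow_on_circle {K : ℂ → ℂ} (hK : Continuous K) (h0 : ∀ z, K z ≠ 0)
    (a : ℂ) (n : ℤ) {r : ℝ} (hr : 0 < r) (h : ∀ z, ‖z - a‖ = r → K z = (z - a) ^ n) : n = 0 := by
  obtain ⟨L, hL, hL'⟩ := exists_continuous_log hK h0
  have key : ∀ θ : ℝ, Complex.exp
      (L (a + r * Complex.exp (θ * Complex.I)) - n * (Real.log r + θ * Complex.I)) = 1 := by
    intro θ
    have : Complex.exp (Real.log r : ℂ) = r := by
      rw [← Complex.ofReal_exp, Real.exp_log hr]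
    rw [Complex.exp_sub, hL' _, h _ (by simp [Complex.norm_exp_ofReal_mul_I, hr.le]),
      Complex.exp_int_mul, Complex.exp_add, this]
    rw [add_sub_cancel_left]
    exact div_self (zpow_ne_zero _ (mul_ne_zero (by exact_mod_cast hr.ne') (Complex.exp_ne_zero _)))
  obtain ⟨m, hm⟩ := exists_int_of_exp_eq_one (X := (Set.univ : Set ℝ)) isPreconnected_univ
    (g := fun θ : ℝ => L (a + r * Complex.exp (θ * Complex.I))
      - n * (Real.log r + θ * Complex.I)) (by fun_prop) (fun θ _ => key θ)
  have e0 := hm 0 trivial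
  have e1 := hm (2 * Real.pi) trivial
  have : Complex.exp ((2 * Real.pi : ℝ) * Complex.I) = 1 := by
    push_cast; exact Complex.exp_two_pi_mul_I
  simp only [this] at e1
  simp only [Complex.ofReal_zero, zero_mul, Complex.exp_zero] at e0
  rw [← e1] at e0
  have h3 : (n : ℂ) * ((2 * Real.pi : ℝ) * Complex.I) = 0 := by linear_combination e0
  have : ((2 * Real.pi : ℝ) * Complex.I : ℂ) ≠ 0 := by
    simp [Real.pi_ne_zero]
  exact_mod_cast (mul_eq_zero.1 h3).resolve_right this

lemma frontier_connectedComponentIn_subset {E : Type*} [TopologicalSpace E]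
    [LocallyConnectedSpace E] {X : Set E} (hX : IsClosed X) (a : E) :
    frontier (connectedComponentIn Xᶜ a) ⊆ X := by
  intro z hz
  by_contra hzX
  have ho : IsOpen (connectedComponentIn Xᶜ z) := hX.isOpen_compl.connectedComponentIn
  have hzc := mem_connectedComponentIn (F := Xᶜ) hzX
  obtain ⟨w, hw1, hw2⟩ := mem_closure_iff.1 hz.1 _ ho hzc
  have := connectedComponentIn_eq hw1
  have := connectedComponentIn_eq hw2
  have hz2 := hz.2
  rw [(hX.isOpen_compl.connectedComponentIn).interior_eq] at hz2
  apply hz2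
  simp_all

lemma closure_connectedComponentIn_subset {E : Type*} [TopologicalSpace E]
    [LocallyConnectedSpace E] {X : Set E} (hX : IsClosed X) (a : E) :
    closure (connectedComponentIn Xᶜ a) ⊆ connectedComponentIn Xᶜ a ∪ X := by
  rw [closure_eq_self_union_frontier]
  exact Set.union_subset_union_right _ (frontier_connectedComponentIn_subset hX a)

lemma int_eq_zero_of_hasLogOn {X : Set ℂ} (hX : IsCompact X) {a : ℂ} (ha : a ∉ X)
    (hb : Bornology.IsBounded (connectedComponentIn Xᶜ a)) {R : ℂ → ℂ}
    (hR : ContinuousOn R (closure (connectedComponentIn Xᶜ a)))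
    (hR0 : ∀ z ∈ closure (connectedComponentIn Xᶜ a), R z ≠ 0) {n : ℤ}
    (h : HasLogOn X (fun z => (z - a) ^ n * R z)) : n = 0 := by
  set U := connectedComponentIn Xᶜ a with hU
  obtain ⟨g, hg, hg'⟩ := h
  obtain ⟨G, hG⟩ := ContinuousMap.exists_restrict_eq hX.isClosed ⟨X.domRestrict g, hg.domRestrict⟩
  have hG' : ∀ z ∈ X, G z = g z := fun z hz => DFunLike.congr_fun hG ⟨z, hz⟩
  have haU : a ∈ U := mem_connectedComponentIn ha
  have hUo : IsOpen U := hX.isClosed.isOpen_compl.connectedComponentIn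
  have hfr := frontier_connectedComponentIn_subset hX.isClosed a
  let K : ℂ → ℂ := fun z => if z ∈ U then Complex.exp (G z) / R z else (z - a) ^ n
  have hcl : closure {z | z ∉ U} = {z | z ∉ U} := hUo.isClosed_compl.closure_eq
  have hK : Continuous K := by
    refine continuous_if ?_ ?_ ?_
    · intro z hz
      have hzX := hfr hz
      simp only [hG' z hzX, hg' z hzX]
      exact mul_div_cancel_right₀ _ (hR0 z (frontier_subset_closure hz))
    · exact ContinuousOn.div (by fun_prop) hR hR0
    · rw [hcl]
      refine ContinuousOn.zpow₀ (by fun_prop) _ fun z hz => Or.inl ?_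
      rintro h
      rw [sub_eq_zero] at h
      exact hz (h ▸ haU)
  have hK0 : ∀ z, K z ≠ 0 := by
    intro z
    by_cases hz : z ∈ U
    · simp only [K, hz, if_true]
      exact div_ne_zero (Complex.exp_ne_zero _) (hR0 z (subset_closure hz))
    · simp only [K, hz, if_false]
      refine zpow_ne_zero _ fun h => ?_
      rw [sub_eq_zero] at h
      exact hz (h ▸ haU)
  obtain ⟨r, hr⟩ := (Metric.isBounded_iff_subset_closedBall a).1 hb
  refine int_eq_zero_of_eq_zpow_on_circle hK hK0 a n (r := max r 0 + 1) (by positivity) ?_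
  intro z hz
  have : z ∉ U := fun h => by
    have := hr h
    rw [mem_closedBall_iff_norm, hz] at this
    linarith [le_max_left r 0]
  simp [K, this]

lemma isPreconnected_norm_gt (R : ℝ) (hR : 0 < R) : IsPreconnected {z : ℂ | R < ‖z‖} := by
  have : {z : ℂ | R < ‖z‖} = Complex.exp '' {w : ℂ | Real.log R < w.re} := by
    ext z
    constructor
    · intro hz
      have hz0 : z ≠ 0 := by
        rintro rfl
        simp only [Set.mem_ofPred_eq, norm_zero] at hz
        linarith
      exact ⟨Complex.log z, by simpa [Complex.log_re] using Real.log_lt_log hR hz,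
        Complex.exp_log hz0⟩
    · rintro ⟨w, hw, rfl⟩
      simp only [Set.mem_ofPred_eq, Complex.norm_exp] at hw ⊢
      rwa [← Real.log_lt_iff_lt_exp hR]
  rw [this]
  exact (convex_halfSpace_re_gt _).isPreconnected.image _ Complex.continuous_exp.continuousOn

lemma isBounded_or_isBounded_of_not_linkedOff {X : Set ℂ} (hX : IsCompact X) {a b : ℂ}
    (h : ¬ LinkedOff X a b) : Bornology.IsBounded (connectedComponentIn Xᶜ a) ∨
      Bornology.IsBounded (connectedComponentIn Xᶜ b) := by
  obtain ⟨r, hr⟩ := (Metric.isBounded_iff_subset_closedBall 0).1 hX.isBounded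
  have hsub : {z : ℂ | max r 1 < ‖z‖} ⊆ Xᶜ := fun z hz hzX => by
    have := hr hzX
    rw [mem_closedBall_iff_norm, sub_zero] at this
    have h3 : max r 1 < ‖z‖ := hz
    linarith [le_max_left r 1]
  by_contra! hcon
  apply h
  have key : ∀ c : ℂ, ¬ Bornology.IsBounded (connectedComponentIn Xᶜ c) →
      ∃ z, max r 1 < ‖z‖ ∧ LinkedOff X c z := by
    intro c hc
    by_contra! hcon
    apply hc
    refine (Metric.isBounded_iff_subset_closedBall 0).2 ⟨max r 1, fun z hz => ?_⟩
    rw [mem_closedBall_iff_norm, sub_zero]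
    by_contra! hz'
    exact hcon z hz' (LinkedOff.iff_mem_connectedComponentIn.2 hz)
  obtain ⟨z, hz, hz'⟩ := key a hcon.1
  obtain ⟨w, hw, hw'⟩ := key b hcon.2
  exact (hz'.trans ⟨_, isPreconnected_norm_gt _ (by positivity), hsub, hz, hw⟩).trans hw'.symm

lemma HasLogOn.of_linkedOff {X : Set ℂ} (hX : IsClosed X) {a b : ℂ} (h : LinkedOff X a b) :
    HasLogOn X (fun z => (z - a) / (z - b)) := by
  obtain ⟨t, ht, htX, hat, hbt⟩ := h
  have hne : ∀ c ∈ t, ∀ z ∈ X, z - c ≠ 0 := fun c hc z hz h => by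
    rw [sub_eq_zero] at h
    exact htX hc (h ▸ hz)
  refine IsPreconnected.induction₂' ht (fun a b => HasLogOn X (fun z => (z - a) / (z - b)))
    ?_ ?_ hat hbt
  · intro c hc
    have hcX : c ∈ Xᶜ := htX hc
    obtain ⟨ε, hε, hball⟩ := Metric.isOpen_iff.1 hX.isOpen_compl c hcX
    filter_upwards [mem_nhdsWithin_of_mem_nhds (Metric.ball_mem_nhds c hε),
      self_mem_nhdsWithin] with d hd hdt
    have main : HasLogOn X (fun z => (z - d) / (z - c)) := by
      refine ⟨fun z => Complex.log ((z - d) / (z - c)), ?_, fun z hz =>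
        Complex.exp_log (div_ne_zero (hne d hdt z hz) (hne c hc z hz))⟩
      refine ContinuousOn.clog (ContinuousOn.div (by fun_prop) (by fun_prop)
        fun z hz => hne c hc z hz) fun z hz => ?_
      have h1 : (z - d) / (z - c) = 1 + (c - d) / (z - c) := by
        have := hne c hc z hz
        field_simp
        ring
      rw [h1]
      apply Complex.mem_slitPlane_of_norm_lt_one
      have hzc : ε ≤ ‖z - c‖ := by
        by_contra! hlt
        exact hball (mem_ball_iff_norm.2 hlt) hz
      rw [norm_div, div_lt_one (hε.trans_le hzc), norm_sub_rev]
      exact (mem_ball_iff_norm.1 hd).trans_le hzc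
    refine ⟨(main.zpow (-1)).congr fun z hz => ?_, main⟩
    simp
  · intro x y z hx hy hz hxy hyz
    refine (hxy.mul hyz).congr fun w hw => ?_
    have := hne y hy w hw
    have := hne z hz w hw
    field_simp

/-- Eilenberg's criterion. -/
lemma linkedOff_iff_hasLogOn {X : Set ℂ} (hX : IsCompact X) {a b : ℂ} (ha : a ∉ X) (hb : b ∉ X) :
    LinkedOff X a b ↔ HasLogOn X (fun z => (z - a) / (z - b)) := by
  refine ⟨HasLogOn.of_linkedOff hX.isClosed, fun h => ?_⟩
  by_contra hcon
  have key : ∀ a b : ℂ, a ∉ X → b ∉ X → HasLogOn X (fun z => (z - a) / (z - b)) →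
      ¬ LinkedOff X a b → ¬ Bornology.IsBounded (connectedComponentIn Xᶜ a) := by
    intro a b ha hb h hcon hbd
    have hne : ∀ z ∈ closure (connectedComponentIn Xᶜ a), z - b ≠ 0 := by
      intro z hz h0
      rw [sub_eq_zero] at h0
      subst h0
      rcases closure_connectedComponentIn_subset hX.isClosed a hz with h1 | h1
      · exact hcon (LinkedOff.iff_mem_connectedComponentIn.2 h1)
      · exact hb h1
    have := int_eq_zero_of_hasLogOn hX ha hbd (R := fun z => (z - b)⁻¹) (n := 1)
      (ContinuousOn.inv₀ (by fun_prop) hne) (fun z hz => inv_ne_zero (hne z hz))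
      (h.congr fun z _ => by simp [div_eq_mul_inv])
    simp at this
  rcases isBounded_or_isBounded_of_not_linkedOff hX hcon with h1 | h1
  · exact key a b ha hb h hcon h1
  · exact key b a hb ha ((h.zpow (-1)).congr fun z _ => by simp) (fun h => hcon h.symm) h1

/-- Two continuous logarithms on compact sets glue if they differ by a constant on the
intersection. -/
lemma HasLogOn.union {X Y : Set ℂ} {φ : ℂ → ℂ} (hX : IsClosed X) (hY : IsClosed Y)
    {g h : ℂ → ℂ} (hg : ContinuousOn g X) (hg' : ∀ z ∈ X, Complex.exp (g z) = φ z)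
    (hh : ContinuousOn h Y) (hh' : ∀ z ∈ Y, Complex.exp (h z) = φ z) {n : ℤ}
    (hn : ∀ z ∈ X ∩ Y, g z - h z = n * (2 * Real.pi * Complex.I)) : HasLogOn (X ∪ Y) φ := by
  let k : ℂ → ℂ := fun z => if z ∈ X then g z else h z + n * (2 * Real.pi * Complex.I)
  have kX : ∀ z ∈ X, k z = g z := fun z hz => by simp [k, hz]
  have kY : ∀ z ∈ Y, k z = h z + n * (2 * Real.pi * Complex.I) := fun z hz => by
    by_cases hzX : z ∈ X
    · rw [kX z hzX, ← hn z ⟨hzX, hz⟩]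
      ring
    · simp [k, hzX]
  refine ⟨k, ContinuousOn.union_of_isClosed (hg.congr kX)
    ((hh.add continuousOn_const).congr kY) hX hY, ?_⟩
  rintro z (hz | hz)
  · rw [kX z hz, hg' z hz]
  · rw [kY z hz, Complex.exp_add, Complex.exp_int_mul_two_pi_mul_I, mul_one, hh' z hz]

lemma exp_sub_eq_one_of_logs {g h : ℂ → ℂ} {φ : ℂ → ℂ} {z : ℂ} (hg : Complex.exp (g z) = φ z)
    (hh : Complex.exp (h z) = φ z) : Complex.exp (g z - h z) = 1 := by
  rw [Complex.exp_sub, hg, hh, div_self]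
  exact hh ▸ Complex.exp_ne_zero _

/-- Janiszewski's theorem in the complex plane. -/
lemma LinkedOff.union_complex {X Y : Set ℂ} (hX : IsCompact X) (hY : IsCompact Y)
    (hXY : IsPreconnected (X ∩ Y)) {a b : ℂ} (h : LinkedOff X a b) (h' : LinkedOff Y a b) :
    LinkedOff (X ∪ Y) a b := by
  have ha : a ∉ X ∪ Y := by simp [h.notMem_left, h'.notMem_left]
  have hb : b ∉ X ∪ Y := by simp [h.notMem_right, h'.notMem_right]
  rw [linkedOff_iff_hasLogOn (hX.union hY) ha hb]
  obtain ⟨g, hg, hg'⟩ := HasLogOn.of_linkedOff hX.isClosed h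
  obtain ⟨k, hk, hk'⟩ := HasLogOn.of_linkedOff hY.isClosed h'
  obtain ⟨n, hn⟩ := exists_int_of_exp_eq_one (g := fun z => g z - k z) hXY
    ((hg.mono Set.inter_subset_left).sub (hk.mono Set.inter_subset_right))
    (fun z hz => exp_sub_eq_one_of_logs (φ := fun z => (z - a) / (z - b)) (hg' z hz.1)
      (hk' z hz.2))
  exact HasLogOn.union hX.isClosed hY.isClosed hg hg' hk hk' hn

lemma hasLogOn_arc {γ : ℝ → ℂ} {s t : ℝ} (hγ : ContinuousOn γ (Set.Icc s t))
    (hinj : Set.InjOn γ (Set.Icc s t)) {φ : ℂ → ℂ} (hφ : ContinuousOn φ (γ '' Set.Icc s t))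
    (h0 : ∀ z ∈ γ '' Set.Icc s t, φ z ≠ 0) : HasLogOn (γ '' Set.Icc s t) φ := by
  rcases le_or_gt s t with hst | hst
  swap
  · exact ⟨0, by simp [hst], by simp [hst]⟩
  have hF : Topology.IsClosedEmbedding ((Set.Icc s t).domRestrict γ) :=
    Continuous.isClosedEmbedding hγ.domRestrict (Set.injOn_iff_injective.1 hinj)
  have hφγ : Continuous (Set.IccExtend hst ((Set.Icc s t).domRestrict (φ ∘ γ))) := by
    refine Continuous.Icc_extend' ?_
    exact (hφ.comp hγ (Set.mapsTo_image _ _)).domRestrict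
  obtain ⟨L, hL, hL'⟩ := exists_continuous_log hφγ (fun z => by
    simp only [Set.IccExtend, Function.comp, Set.domRestrict]
    exact h0 _ ⟨_, (Set.projIcc s t hst z).2, rfl⟩)
  obtain ⟨g, hg⟩ := ContinuousMap.exists_extension hF
    ⟨(Set.Icc s t).domRestrict L, hL.continuousOn.domRestrict⟩
  refine ⟨g, g.continuous.continuousOn, ?_⟩
  rintro _ ⟨u, hu, rfl⟩
  have h1 : g (γ u) = L u := DFunLike.congr_fun hg ⟨u, hu⟩
  rw [h1, hL', Set.IccExtend_of_mem _ _ hu]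
  rfl

lemma continuousOn_div_sub {X : Set ℂ} {a b : ℂ} (hb : b ∉ X) :
    ContinuousOn (fun z => (z - a) / (z - b)) X := by
  refine ContinuousOn.div (by fun_prop) (by fun_prop) fun z hz h => ?_
  rw [sub_eq_zero] at h
  exact hb (h ▸ hz)

lemma div_sub_ne_zero {X : Set ℂ} {a b : ℂ} (ha : a ∉ X) (hb : b ∉ X) :
    ∀ z ∈ X, (z - a) / (z - b) ≠ 0 := by
  intro z hz
  refine div_ne_zero (fun h => ?_) (fun h => ?_) <;> rw [sub_eq_zero] at h
  · exact ha (h ▸ hz)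
  · exact hb (h ▸ hz)

lemma linkedOff_arc_complex {γ : ℝ → ℂ} {s t : ℝ} (hγ : ContinuousOn γ (Set.Icc s t))
    (hinj : Set.InjOn γ (Set.Icc s t)) {a b : ℂ} (ha : a ∉ γ '' Set.Icc s t)
    (hb : b ∉ γ '' Set.Icc s t) : LinkedOff (γ '' Set.Icc s t) a b := by
  rw [linkedOff_iff_hasLogOn (isCompact_Icc.image_of_continuousOn hγ) ha hb]
  exact hasLogOn_arc hγ hinj (continuousOn_div_sub hb) (div_sub_ne_zero ha hb)

/-- Attaching an arc splits a complementary component into at most two pieces. -/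
lemma linkedOff_union_arc_complex {K : Set ℂ} (hK : IsCompact K) {γ : ℝ → ℂ}
    (hγ : ContinuousOn γ (Set.Icc 0 1)) (hinj : Set.InjOn γ (Set.Icc 0 1))
    (hKA : K ∩ γ '' Set.Icc 0 1 ⊆ {γ 0, γ 1}) {a b c : ℂ} (ha : a ∉ γ '' Set.Icc 0 1)
    (hb : b ∉ γ '' Set.Icc 0 1) (hc : c ∉ γ '' Set.Icc 0 1)
    (hab : LinkedOff K a b) (hac : LinkedOff K a c) :
    LinkedOff (K ∪ γ '' Set.Icc 0 1) a b ∨ LinkedOff (K ∪ γ '' Set.Icc 0 1) a c ∨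
      LinkedOff (K ∪ γ '' Set.Icc 0 1) b c := by
  set A := γ '' Set.Icc 0 1 with hA
  have hAc : IsCompact A := isCompact_Icc.image_of_continuousOn hγ
  have hsub : ∀ b, b ∉ A → LinkedOff A a b := fun b hb => linkedOff_arc_complex hγ hinj ha hb
  by_cases hpre : IsPreconnected (K ∩ A)
  · exact Or.inl (hab.union_complex hK hAc hpre (hsub b hb))
  have h0 : γ 0 ∈ K := by
    by_contra h
    refine hpre (Set.Subsingleton.isPreconnected (Set.subsingleton_of_subset_singleton
      (a := γ 1) fun z hz => ?_))
    rcases hKA hz with rfl | h1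
    · exact absurd hz.1 h
    · exact h1
  have h1 : γ 1 ∈ K := by
    by_contra h
    refine hpre (Set.Subsingleton.isPreconnected (Set.subsingleton_of_subset_singleton
      (a := γ 0) fun z hz => ?_))
    rcases hKA hz with h1 | h1
    · exact h1
    · exact absurd (h1 ▸ hz.1) h
  have h0A : γ 0 ∈ A := ⟨0, by simp, rfl⟩
  have h1A : γ 1 ∈ A := ⟨1, by simp, rfl⟩
  -- normalised logarithms and the defect at the far endpoint
  have key : ∀ b, b ∉ A → LinkedOff K a b → ∃ g h : ℂ → ℂ, ∃ k : ℤ,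
      ContinuousOn g K ∧ ContinuousOn h A ∧
      (∀ z ∈ K, Complex.exp (g z) = (z - a) / (z - b)) ∧
      (∀ z ∈ A, Complex.exp (h z) = (z - a) / (z - b)) ∧ g (γ 0) - h (γ 0) = 0 ∧
      g (γ 1) - h (γ 1) = k * (2 * Real.pi * Complex.I) := by
    intro b hb hab
    obtain ⟨g, hg, hg'⟩ := HasLogOn.of_linkedOff hK.isClosed hab
    obtain ⟨h, hh, hh'⟩ := HasLogOn.of_linkedOff hAc.isClosed (hsub b hb)
    obtain ⟨n, hn⟩ := Complex.exp_eq_one_iff.1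
      (exp_sub_eq_one_of_logs (φ := fun z => (z - a) / (z - b)) (hg' _ h0) (hh' _ h0A))
    obtain ⟨m, hm⟩ := Complex.exp_eq_one_iff.1
      (exp_sub_eq_one_of_logs (φ := fun z => (z - a) / (z - b)) (hg' _ h1) (hh' _ h1A))
    refine ⟨g, fun z => h z + n * (2 * Real.pi * Complex.I), m - n, hg,
      hh.add continuousOn_const, hg', fun z hz => ?_, ?_, ?_⟩
    · rw [Complex.exp_add, Complex.exp_int_mul_two_pi_mul_I, mul_one, hh' z hz]
    · rw [← hn]; ring
    · push_cast
      linear_combination hm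
  obtain ⟨g, h, k, hg, hh, hg', hh', e0, e1⟩ := key b hb hab
  obtain ⟨g₂, h₂, k₂, hg₂, hh₂, hg₂', hh₂', e0₂, e1₂⟩ := key c hc hac
  by_contra! hcon
  obtain ⟨nab, nac, nbc⟩ := hcon
  have ha' : a ∉ K ∪ A := by simp [hab.notMem_left, ha]
  have hb' : b ∉ K ∪ A := by simp [hab.notMem_right, hb]
  have hc' : c ∉ K ∪ A := by simp [hac.notMem_right, hc]
  have hX : IsCompact (K ∪ A) := hK.union hAc
  have glue : ∀ (g h : ℂ → ℂ) (φ : ℂ → ℂ), ContinuousOn g K → ContinuousOn h A →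
      (∀ z ∈ K, Complex.exp (g z) = φ z) → (∀ z ∈ A, Complex.exp (h z) = φ z) →
      g (γ 0) - h (γ 0) = 0 → g (γ 1) - h (γ 1) = 0 → HasLogOn (K ∪ A) φ := by
    intro g h φ hg hh hg' hh' e0 e1
    refine HasLogOn.union hK.isClosed hAc.isClosed hg hg' hh hh' (n := 0) fun z hz => ?_
    rcases hKA hz with rfl | h1
    · simpa using e0
    · rw [Set.mem_singleton_iff.1 h1]
      simpa using e1
  have hk : k ≠ 0 := by
    rintro rfl
    apply nab
    rw [linkedOff_iff_hasLogOn hX ha' hb']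
    exact glue g h _ hg hh hg' hh' e0 (by simpa using e1)
  have hk₂ : k₂ ≠ 0 := by
    rintro rfl
    apply nac
    rw [linkedOff_iff_hasLogOn hX ha' hc']
    exact glue g₂ h₂ _ hg₂ hh₂ hg₂' hh₂' e0₂ (by simpa using e1₂)
  have hlog : HasLogOn (K ∪ A)
      (fun z => ((z - a) / (z - b)) ^ k₂ * ((z - a) / (z - c)) ^ (-k)) := by
    refine glue (fun z => k₂ * g z + (-k : ℤ) * g₂ z) (fun z => k₂ * h z + (-k : ℤ) * h₂ z) _
      (by fun_prop) (by fun_prop) (fun z hz => ?_) (fun z hz => ?_) ?_ ?_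
    · rw [Complex.exp_add, Complex.exp_int_mul, Complex.exp_int_mul, hg' z hz, hg₂' z hz]
    · rw [Complex.exp_add, Complex.exp_int_mul, Complex.exp_int_mul, hh' z hz, hh₂' z hz]
    · push_cast
      linear_combination k₂ * e0 - k * e0₂
    · push_cast
      linear_combination k₂ * e1 - k * e1₂
  have hsubne : ∀ b a, ¬ LinkedOff (K ∪ A) b a → a ∉ K ∪ A →
      ∀ z ∈ closure (connectedComponentIn (K ∪ A)ᶜ b), z - a ≠ 0 := by
    intro b a hn ha' z hz hza
    rw [sub_eq_zero] at hza
    subst hza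
    rcases closure_connectedComponentIn_subset hX.isClosed b hz with h1 | h1
    · exact hn (LinkedOff.iff_mem_connectedComponentIn.2 h1)
    · exact ha' h1
  have bd : ∀ (b c : ℂ) (m n : ℤ), m ≠ 0 → b ∉ K ∪ A → c ∉ K ∪ A → ¬ LinkedOff (K ∪ A) a b →
      ¬ LinkedOff (K ∪ A) b c →
      HasLogOn (K ∪ A) (fun z => ((z - a) / (z - b)) ^ m * ((z - a) / (z - c)) ^ n) →
      ¬ Bornology.IsBounded (connectedComponentIn (K ∪ A)ᶜ b) := by
    intro b c m n hm hb hc hab hbc hlog hbd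
    have hza := hsubne b a (fun h => hab h.symm) ha'
    have hzc := hsubne b c hbc hc
    refine hm (neg_eq_zero.1 (int_eq_zero_of_hasLogOn hX hb hbd (n := -m)
      (R := fun z => (z - a) ^ m * ((z - a) / (z - c)) ^ n) ?_ ?_ (hlog.congr ?_)))
    · refine ContinuousOn.mul (ContinuousOn.zpow₀ (by fun_prop) _ fun z hz => Or.inl (hza z hz))
        (ContinuousOn.zpow₀ (ContinuousOn.div (by fun_prop) (by fun_prop) hzc) _
          fun z hz => Or.inl (div_ne_zero (hza z hz) (hzc z hz)))
    · exact fun z hz => mul_ne_zero (zpow_ne_zero _ (hza z hz))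
        (zpow_ne_zero _ (div_ne_zero (hza z hz) (hzc z hz)))
    · intro z hz
      rw [div_zpow, zpow_neg, div_eq_mul_inv]
      ring
  rcases isBounded_or_isBounded_of_not_linkedOff hX nbc with h | h
  · exact bd b c _ _ hk₂ hb' hc' nab nbc hlog h
  · exact bd c b _ _ (neg_ne_zero.2 hk) hc' hb' nac (fun h => nbc h.symm)
      (hlog.congr fun z _ => mul_comm _ _) h

/-- The plane `ℝ × ℝ` identified with `ℂ`. -/
def planeHomeo : ℝ × ℝ ≃ₜ ℂ := Complex.equivRealProdCLM.symm.toHomeomorph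

/-- Janiszewski's theorem in the plane. -/
lemma LinkedOff.union {X Y : Set (ℝ × ℝ)} (hX : IsCompact X) (hY : IsCompact Y)
    (hXY : IsPreconnected (X ∩ Y)) {a b : ℝ × ℝ} (h : LinkedOff X a b) (h' : LinkedOff Y a b) :
    LinkedOff (X ∪ Y) a b := by
  rw [← LinkedOff.image_iff planeHomeo, Set.image_union]
  refine LinkedOff.union_complex (hX.image planeHomeo.continuous)
    (hY.image planeHomeo.continuous) ?_ (h.image _) (h'.image _)
  rw [← Set.image_inter planeHomeo.injective]
  exact hXY.image _ planeHomeo.continuous.continuousOn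

lemma linkedOff_arc {γ : ℝ → ℝ × ℝ} {s t : ℝ} (hγ : ContinuousOn γ (Set.Icc s t))
    (hinj : Set.InjOn γ (Set.Icc s t)) {a b : ℝ × ℝ} (ha : a ∉ γ '' Set.Icc s t)
    (hb : b ∉ γ '' Set.Icc s t) : LinkedOff (γ '' Set.Icc s t) a b := by
  have e : (planeHomeo ∘ γ) '' Set.Icc s t = planeHomeo '' (γ '' Set.Icc s t) :=
    Set.image_comp _ _ _
  rw [← LinkedOff.image_iff planeHomeo, ← e]
  refine linkedOff_arc_complex (planeHomeo.continuous.comp_continuousOn hγ)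
    (planeHomeo.injective.comp_injOn hinj) ?_ ?_ <;>
  · rw [e]
    rwa [planeHomeo.injective.mem_set_image]

lemma linkedOff_union_arc {K : Set (ℝ × ℝ)} (hK : IsCompact K) {γ : ℝ → ℝ × ℝ}
    (hγ : ContinuousOn γ (Set.Icc 0 1)) (hinj : Set.InjOn γ (Set.Icc 0 1))
    (hKA : K ∩ γ '' Set.Icc 0 1 ⊆ {γ 0, γ 1}) {a b c : ℝ × ℝ} (ha : a ∉ γ '' Set.Icc 0 1)
    (hb : b ∉ γ '' Set.Icc 0 1) (hc : c ∉ γ '' Set.Icc 0 1)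
    (hab : LinkedOff K a b) (hac : LinkedOff K a c) :
    LinkedOff (K ∪ γ '' Set.Icc 0 1) a b ∨ LinkedOff (K ∪ γ '' Set.Icc 0 1) a c ∨
      LinkedOff (K ∪ γ '' Set.Icc 0 1) b c := by
  have e : (planeHomeo ∘ γ) '' Set.Icc 0 1 = planeHomeo '' (γ '' Set.Icc 0 1) :=
    Set.image_comp _ _ _
  simp only [← LinkedOff.image_iff planeHomeo, Set.image_union, ← e]
  refine linkedOff_union_arc_complex (hK.image planeHomeo.continuous)
    (planeHomeo.continuous.comp_continuousOn hγ)
    (planeHomeo.injective.comp_injOn hinj) ?_ ?_ ?_ ?_ (hab.image _) (hac.image _)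
  · rw [e, ← Set.image_inter planeHomeo.injective]
    refine (Set.image_mono hKA).trans ?_
    simp [Set.image_pair]
  all_goals rw [e]; rwa [planeHomeo.injective.mem_set_image]

lemma LinkedOff.of_mem_closure {E : Type*} [TopologicalSpace E] {X f : Set E} {a z : E}
    (hf : IsPreconnected f) (hfX : Disjoint f X) (ha : a ∈ f) (hz : z ∈ closure f)
    (hzX : z ∉ X) : LinkedOff X a z := by
  refine ⟨insert z f, hf.subset_closure (Set.subset_insert _ _)
    (Set.insert_subset hz subset_closure), ?_, Set.mem_insert_of_mem _ ha, Set.mem_insert _ _⟩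
  exact Set.insert_subset hzX hfX.subset_compl_right

namespace IsFaceOf

variable {D D₀ f g : Set (ℝ × ℝ)} {a b : ℝ × ℝ}

lemma eq_connectedComponentIn (h : IsFaceOf D f) (ha : a ∈ f) :
    f = connectedComponentIn Dᶜ a := by
  obtain ⟨z, hz, rfl⟩ := h
  exact connectedComponentIn_eq ha

lemma isPreconnected (h : IsFaceOf D f) : IsPreconnected f := by
  obtain ⟨z, hz, rfl⟩ := h
  exact isPreconnected_connectedComponentIn

lemma nonempty (h : IsFaceOf D f) : f.Nonempty := by
  obtain ⟨z, hz, rfl⟩ := h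
  exact ⟨z, mem_connectedComponentIn hz⟩

lemma disjoint (h : IsFaceOf D f) : Disjoint f D := by
  obtain ⟨z, hz, rfl⟩ := h
  exact Set.disjoint_left.2 fun w hw => connectedComponentIn_subset _ _ hw

lemma isOpen (h : IsFaceOf D f) (hD : IsClosed D) : IsOpen f := by
  obtain ⟨z, hz, rfl⟩ := h
  exact hD.isOpen_compl.connectedComponentIn

lemma mem_of_linkedOff (h : IsFaceOf D f) (ha : a ∈ f) (hab : LinkedOff D a b) : b ∈ f := by
  rw [h.eq_connectedComponentIn ha]
  exact LinkedOff.iff_mem_connectedComponentIn.1 hab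

lemma linkedOff (h : IsFaceOf D f) (ha : a ∈ f) (hb : b ∈ f) : LinkedOff D a b :=
  ⟨f, h.isPreconnected, h.disjoint.subset_compl_right, ha, hb⟩

lemma eq_of_linkedOff (h : IsFaceOf D f) (h' : IsFaceOf D g) (ha : a ∈ f) (hb : b ∈ g)
    (hab : LinkedOff D a b) : f = g := by
  rw [h.eq_connectedComponentIn (h.mem_of_linkedOff ha hab), h'.eq_connectedComponentIn hb]

lemma closure_subset (h : IsFaceOf D f) (hD : IsClosed D) : closure f ⊆ f ∪ D := by
  obtain ⟨z, hz, rfl⟩ := h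
  exact closure_connectedComponentIn_subset hD z

/-- A face remains a face when the part of the drawing away from its closure is erased. -/
lemma of_closure_inter_subset (h : IsFaceOf D f) (hD : IsClosed D)
    (h₀ : closure f ∩ D ⊆ D₀) (h₀' : D₀ ⊆ D) : IsFaceOf D₀ f := by
  obtain ⟨a, ha⟩ := h.nonempty
  have haD : a ∉ D₀ := fun h' => Set.disjoint_left.1 h.disjoint ha (h₀' h')
  refine ⟨a, haD, (h.isPreconnected.subset_connectedComponentIn ha
    (h.disjoint.mono_right h₀').subset_compl_right).antisymm ?_⟩
  refine isPreconnected_connectedComponentIn.subset_of_closure_inter_subset (h.isOpen hD)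
    ⟨a, mem_connectedComponentIn haD, ha⟩ ?_
  rintro z ⟨hz, hz'⟩
  rcases h.closure_subset hD hz with h1 | h1
  · exact h1
  · exact absurd (h₀ ⟨hz, h1⟩) (connectedComponentIn_subset _ _ hz')

end IsFaceOf

namespace PlaneEmbedding

variable {V : Type*} {G : SimpleGraph V} (emb : PlaneEmbedding G)

/-- The union of the arcs drawing the edges in `S`. -/
def draw (S : Set (Sym2 V)) : Set (ℝ × ℝ) := ⋃ e ∈ S, arcSet emb e

/-- The arc of `e` without its endpoints. -/
def openArc (e : Sym2 V) : Set (ℝ × ℝ) := arcSet emb e \ emb.pos '' {w | w ∈ e}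

variable {emb} {S T : Set (Sym2 V)} {e e' : Sym2 V} {u v w : V}

lemma mem_draw {z : ℝ × ℝ} : z ∈ emb.draw S ↔ ∃ e ∈ S, z ∈ arcSet emb e := by
  simp [draw]

lemma arcSet_subset_draw (he : e ∈ S) : arcSet emb e ⊆ emb.draw S :=
  fun _ hz => mem_draw.2 ⟨e, he, hz⟩

lemma draw_mono (h : S ⊆ T) : emb.draw S ⊆ emb.draw T :=
  Set.biUnion_subset_biUnion_left h

lemma draw_union : emb.draw (S ∪ T) = emb.draw S ∪ emb.draw T :=
  Set.biUnion_union _ _ _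

lemma draw_insert : emb.draw (insert e S) = arcSet emb e ∪ emb.draw S :=
  Set.biUnion_insert _ _ _

lemma draw_diff_union (he : e ∈ S) : emb.draw (S \ {e}) ∪ arcSet emb e = emb.draw S := by
  rw [Set.union_comm, ← draw_insert, Set.insert_sdiff_singleton, Set.insert_eq_of_mem he]

lemma exists_curve (h : G.Adj u v) : ∃ γ : ℝ → ℝ × ℝ,
    ContinuousOn γ (Set.Icc 0 1) ∧ Set.InjOn γ (Set.Icc 0 1) ∧
      γ 0 = emb.pos u ∧ γ 1 = emb.pos v ∧ γ '' Set.Icc 0 1 = arcSet emb s(u, v) :=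
  emb.arc_curve u v h

lemma pos_mem_arcSet (he : e ∈ G.edgeSet) : emb.pos w ∈ arcSet emb e ↔ w ∈ e := by
  induction e with | _ u v
  constructor
  · intro h
    exact Sym2.mem_iff.2 (emb.arc_vertex u v he w h)
  · intro h
    obtain ⟨γ, -, -, h0, h1, h2⟩ := emb.exists_curve (G.mem_edgeSet.1 he)
    rw [← h2]
    rcases Sym2.mem_iff.1 h with rfl | rfl
    · exact ⟨0, by simp, h0⟩
    · exact ⟨1, by simp, h1⟩

lemma isCompact_arcSet (he : e ∈ G.edgeSet) : IsCompact (arcSet emb e) := by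
  induction e with | _ u v
  obtain ⟨γ, hγ, -, -, -, h2⟩ := emb.exists_curve (G.mem_edgeSet.1 he)
  rw [← h2]
  exact isCompact_Icc.image_of_continuousOn hγ

lemma isPreconnected_arcSet (he : e ∈ G.edgeSet) : IsPreconnected (arcSet emb e) := by
  induction e with | _ u v
  obtain ⟨γ, hγ, -, -, -, h2⟩ := emb.exists_curve (G.mem_edgeSet.1 he)
  rw [← h2]
  exact isPreconnected_Icc.image _ hγ

lemma linkedOff_arcSet (he : e ∈ G.edgeSet) {a b : ℝ × ℝ} (ha : a ∉ arcSet emb e)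
    (hb : b ∉ arcSet emb e) : LinkedOff (arcSet emb e) a b := by
  induction e with | _ u v
  obtain ⟨γ, hγ, hi, -, -, h2⟩ := emb.exists_curve (G.mem_edgeSet.1 he)
  rw [← h2] at ha hb ⊢
  exact linkedOff_arc hγ hi ha hb

lemma openArc_eq_image {γ : ℝ → ℝ × ℝ} (hi : Set.InjOn γ (Set.Icc 0 1))
    (h0 : γ 0 = emb.pos u) (h1 : γ 1 = emb.pos v) (h2 : γ '' Set.Icc 0 1 = arcSet emb s(u, v)) :
    emb.openArc s(u, v) = γ '' Set.Ioo 0 1 := by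
  have h3 : {w | w ∈ s(u, v)} = {u, v} := by
    ext w
    simp
  rw [openArc, ← h2, h3, Set.image_pair, ← h0, ← h1, ← Set.image_pair,
    ← hi.image_sdiff_subset (by simp [Set.insert_subset_iff]), Set.Icc_sdiff_both]

lemma isPreconnected_openArc (he : e ∈ G.edgeSet) : IsPreconnected (emb.openArc e) := by
  induction e with | _ u v
  obtain ⟨γ, hγ, hi, h0, h1, h2⟩ := emb.exists_curve (G.mem_edgeSet.1 he)
  rw [openArc_eq_image hi h0 h1 h2]
  exact isPreconnected_Ioo.image _ (hγ.mono Set.Ioo_subset_Icc_self)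

lemma openArc_nonempty (he : e ∈ G.edgeSet) : (emb.openArc e).Nonempty := by
  induction e with | _ u v
  obtain ⟨γ, hγ, hi, h0, h1, h2⟩ := emb.exists_curve (G.mem_edgeSet.1 he)
  rw [openArc_eq_image hi h0 h1 h2]
  exact (Set.nonempty_Ioo.2 one_pos).image _

lemma arcSet_subset_closure_openArc (he : e ∈ G.edgeSet) :
    arcSet emb e ⊆ closure (emb.openArc e) := by
  induction e with | _ u v
  obtain ⟨γ, hγ, hi, h0, h1, h2⟩ := emb.exists_curve (G.mem_edgeSet.1 he)
  rw [openArc_eq_image hi h0 h1 h2, ← h2]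
  have h3 : closure (Set.Ioo (0 : ℝ) 1) = Set.Icc 0 1 := closure_Ioo zero_ne_one
  rw [← h3] at hγ ⊢
  exact hγ.image_closure

lemma arcSet_inter_arcSet (he : e ∈ G.edgeSet) (he' : e' ∈ G.edgeSet) (hne : e ≠ e') {z : ℝ × ℝ}
    (hz : z ∈ arcSet emb e) (hz' : z ∈ arcSet emb e') : ∃ w ∈ e, w ∈ e' ∧ emb.pos w = z := by
  have : z ∈ Set.range emb.pos := by
    induction e with | _ u v
    induction e' with | _ u' v'
    exact emb.arc_inter u v u' v' he he' hne ⟨hz, hz'⟩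
  obtain ⟨w, rfl⟩ := this
  exact ⟨w, (pos_mem_arcSet he).1 hz, (pos_mem_arcSet he').1 hz', rfl⟩

lemma pos_notMem_openArc (he : e ∈ G.edgeSet) : emb.pos w ∉ emb.openArc e := fun h =>
  h.2 ⟨w, (pos_mem_arcSet he).1 h.1, rfl⟩

lemma disjoint_openArc_draw (he : e ∈ G.edgeSet) (hS : S ⊆ G.edgeSet) (heS : e ∉ S) :
    Disjoint (emb.openArc e) (emb.draw S) := by
  refine Set.disjoint_left.2 fun z hz hz' => ?_
  obtain ⟨e', he', hz'⟩ := mem_draw.1 hz'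
  obtain ⟨w, -, -, rfl⟩ := arcSet_inter_arcSet he (hS he') (fun h => heS (h ▸ he')) hz.1 hz'
  exact pos_notMem_openArc he hz

lemma pos_mem_draw (hS : S ⊆ G.edgeSet) : emb.pos w ∈ emb.draw S ↔ ∃ e ∈ S, w ∈ e := by
  rw [mem_draw]
  exact exists_congr fun e => and_congr_right fun he => pos_mem_arcSet (hS he)

lemma isCompact_draw [Finite V] (hS : S ⊆ G.edgeSet) : IsCompact (emb.draw S) :=
  S.toFinite.isCompact_biUnion fun _ he => isCompact_arcSet (hS he)

lemma isClosed_draw [Finite V] (hS : S ⊆ G.edgeSet) : IsClosed (emb.draw S) :=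
  (isCompact_draw hS).isClosed

lemma draw_inter (hS : S ⊆ G.edgeSet) (hT : T ⊆ G.edgeSet)
    (h : ∀ w, (∃ e ∈ S, w ∈ e) → (∃ e ∈ T, w ∈ e) → ∃ e ∈ S ∩ T, w ∈ e) :
    emb.draw S ∩ emb.draw T = emb.draw (S ∩ T) := by
  refine Set.Subset.antisymm ?_ (Set.subset_inter (draw_mono Set.inter_subset_left)
    (draw_mono Set.inter_subset_right))
  rintro z ⟨hz, hz'⟩
  obtain ⟨e, he, hz⟩ := mem_draw.1 hz
  obtain ⟨e', he', hz'⟩ := mem_draw.1 hz'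
  by_cases hne : e = e'
  · subst hne
    exact mem_draw.2 ⟨e, ⟨he, he'⟩, hz⟩
  · obtain ⟨w, hw, hw', rfl⟩ := arcSet_inter_arcSet (hS he) (hT he') hne hz hz'
    exact (pos_mem_draw (Set.inter_subset_left.trans hS)).2 (h w ⟨e, he, hw⟩ ⟨e', he', hw'⟩)

lemma isPreconnected_draw_insert (he : e ∈ G.edgeSet) (hS : S ⊆ G.edgeSet)
    (h : IsPreconnected (emb.draw S)) (hw : w ∈ e) (he' : e' ∈ S) (hw' : w ∈ e') :
    IsPreconnected (emb.draw (insert e S)) := by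
  rw [draw_insert]
  exact (isPreconnected_arcSet he).union _ ((pos_mem_arcSet he).2 hw)
    ((pos_mem_draw hS).2 ⟨e', he', hw'⟩) h

end PlaneEmbedding

open PlaneEmbedding

section Faces

variable {V : Type*} [Finite V] {G : SimpleGraph V} {emb : PlaneEmbedding G}
  {S : Set (Sym2 V)} {e e₀ e₁ : Sym2 V} {u : V} {f f₁ f₂ f₃ : Set (ℝ × ℝ)}

/-- If an interior point of the arc of `e` lies on the boundary of a face, so does the
whole arc. -/
lemma incEdge_of_mem_openArc (hS : S ⊆ G.edgeSet) (hf : IsFaceOf (emb.draw S) f) (he : e ∈ S)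
    {z : ℝ × ℝ} (hz : z ∈ emb.openArc e) (hzf : z ∈ closure f) : incEdge emb f e := by
  have heG := hS he
  have hinc : emb.openArc e ⊆ closure f → incEdge emb f e := fun h =>
    (arcSet_subset_closure_openArc heG).trans (closure_minimal h isClosed_closure)
  refine hinc fun q hq => ?_
  by_contra hqf
  have hK : S \ {e} ⊆ G.edgeSet := Set.sdiff_subset.trans hS
  have hdis := disjoint_openArc_draw (emb := emb) heG hK (by simp)
  obtain ⟨a, ha⟩ := hf.nonempty
  have haD : a ∉ emb.draw S := Set.disjoint_left.1 hf.disjoint ha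
  have hKD : emb.draw (S \ {e}) ⊆ emb.draw S := draw_mono Set.sdiff_subset
  have haq : LinkedOff (emb.draw (S \ {e})) a q :=
    (LinkedOff.of_mem_closure hf.isPreconnected (hf.disjoint.mono_right hKD) ha hzf
      (Set.disjoint_left.1 hdis hz)).trans
      ⟨_, isPreconnected_openArc heG, hdis.subset_compl_right, hz, hq⟩
  have hsplit := draw_diff_union (emb := emb) he
  have heD := arcSet_subset_draw (emb := emb) he
  have hKe : ∀ y ∈ emb.draw (S \ {e}), y ∈ arcSet emb e → y ∉ emb.openArc e := fun y hy _ hy' =>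
    Set.disjoint_left.1 hdis hy' hy
  have hKc := isCompact_draw (emb := emb) hK
  generalize emb.draw (S \ {e}) = K at *
  induction e with | _ u v
  obtain ⟨γ, hγ, hi, h0, h1, h2⟩ := emb.exists_curve (G.mem_edgeSet.1 heG)
  rw [openArc_eq_image hi h0 h1 h2] at hq hKe
  rw [← h2] at hsplit heD hKe
  obtain ⟨s, hs, rfl⟩ := hq
  have hnhds : γ ⁻¹' (closure f)ᶜ ∈ nhds s :=
    (hγ.continuousAt (Icc_mem_nhds hs.1 hs.2)).preimage_mem_nhds
      (isClosed_closure.isOpen_compl.mem_nhds hqf)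
  obtain ⟨s₁, s₂, hs', hsub, hsub'⟩ : ∃ s₁ s₂, s ∈ Set.Ioo s₁ s₂ ∧ Set.Ioo s₁ s₂ ⊆ Set.Ioo 0 1 ∧
      Set.Ioo s₁ s₂ ⊆ γ ⁻¹' (closure f)ᶜ := by
    obtain ⟨s₁, s₂, h, h'⟩ := mem_nhds_iff_exists_Ioo_subset.1
      (Filter.inter_mem hnhds (Ioo_mem_nhds hs.1 hs.2))
    exact ⟨s₁, s₂, h, fun y hy => (h' hy).2, fun y hy => (h' hy).1⟩
  obtain ⟨hs₁, hs₂⟩ : 0 ≤ s₁ ∧ s₂ ≤ 1 := by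
    exact (Set.Ioo_subset_Ioo_iff (hs'.1.trans hs'.2)).1 hsub
  have hl : Set.Icc 0 s₁ ⊆ Set.Icc (0 : ℝ) 1 :=
    Set.Icc_subset_Icc_right (by linarith [hs'.1, hs.2])
  have hr : Set.Icc s₂ 1 ⊆ Set.Icc (0 : ℝ) 1 :=
    Set.Icc_subset_Icc_left (by linarith [hs'.2, hs.1])
  have hcl : IsCompact (γ '' Set.Icc 0 s₁) := isCompact_Icc.image_of_continuousOn (hγ.mono hl)
  have hcr : IsCompact (γ '' Set.Icc s₂ 1) := isCompact_Icc.image_of_continuousOn (hγ.mono hr)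
  have haA : a ∉ γ '' Set.Icc 0 1 := fun h => haD (heD h)
  have hql : γ s ∉ γ '' Set.Icc 0 s₁ := by
    rw [hi.mem_image_iff hl ⟨hs.1.le, hs.2.le⟩]
    exact fun h => absurd h.2 (not_le.2 hs'.1)
  have hqr : γ s ∉ γ '' Set.Icc s₂ 1 := by
    rw [hi.mem_image_iff hr ⟨hs.1.le, hs.2.le⟩]
    exact fun h => absurd h.1 (not_le.2 hs'.2)
  have hend : ∀ t ∈ Set.Icc (0 : ℝ) 1, γ t ∈ K → t = 0 ∨ t = 1 := by
    intro t ht htK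
    by_contra! hne
    exact hKe _ htK ⟨t, ht, rfl⟩
      ⟨t, ⟨lt_of_le_of_ne ht.1 hne.1.symm, lt_of_le_of_ne ht.2 hne.2⟩, rfl⟩
  have step1 : LinkedOff (K ∪ γ '' Set.Icc 0 s₁) a (γ s) := by
    refine LinkedOff.union hKc hcl ?_ haq
      (linkedOff_arc (hγ.mono hl) (hi.mono hl) (fun h => haA (Set.image_mono hl h)) hql)
    refine (Set.subsingleton_of_subset_singleton (a := γ 0) ?_).isPreconnected
    rintro _ ⟨hy, t, ht, rfl⟩
    rcases hend t (hl ht) hy with rfl | rfl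
    · rfl
    · exact absurd ht.2 (not_le.2 (by linarith [hs'.1, hs.2]))
  have step2 : LinkedOff (K ∪ γ '' Set.Icc 0 s₁ ∪ γ '' Set.Icc s₂ 1) a (γ s) := by
    refine LinkedOff.union (hKc.union hcl) hcr ?_ step1
      (linkedOff_arc (hγ.mono hr) (hi.mono hr) (fun h => haA (Set.image_mono hr h)) hqr)
    refine (Set.subsingleton_of_subset_singleton (a := γ 1) ?_).isPreconnected
    rintro _ ⟨hy, t, ht, rfl⟩
    rcases hy with hy | hy
    · rcases hend t (hr ht) hy with rfl | rfl
      · exact absurd ht.1 (not_le.2 (by linarith [hs'.2, hs.1]))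
      · rfl
    · rw [hi.mem_image_iff hl (hr ht)] at hy
      exact absurd (ht.1.trans hy.2) (not_le.2 (hs'.1.trans hs'.2))
  have hD := isClosed_draw (emb := emb) hS
  rw [← hsplit] at hf hD
  have hf' := hf.of_closure_inter_subset hD (D₀ := K ∪ γ '' Set.Icc 0 s₁ ∪ γ '' Set.Icc s₂ 1) ?_ ?_
  · exact hqf (subset_closure (hf'.mem_of_linkedOff ha step2))
  · rintro _ ⟨hy, hyK | ⟨t, ht, rfl⟩⟩
    · exact Or.inl (Or.inl hyK)
    · by_cases h3 : t ≤ s₁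
      · exact Or.inl (Or.inr ⟨t, ⟨ht.1, h3⟩, rfl⟩)
      · by_cases h4 : s₂ ≤ t
        · exact Or.inr ⟨t, ⟨h4, ht.2⟩, rfl⟩
        · exact absurd hy (hsub' ⟨not_le.1 h3, not_le.1 h4⟩)
  · rw [Set.union_assoc]
    exact Set.union_subset_union_right _ (Set.union_subset (Set.image_mono hl) (Set.image_mono hr))

/-- A face having a vertex `u` of degree at least two on its boundary is incident with an edge at
`u` other than a prescribed one. -/
lemma exists_incEdge_ne (hS : S ⊆ G.edgeSet) (hf : IsFaceOf (emb.draw S) f)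
    (hu : incVertex emb f u) (he₀ : e₀ ∈ S) (he₁ : e₁ ∈ S) (hu₀ : u ∈ e₀) (hu₁ : u ∈ e₁)
    (hne : e₁ ≠ e₀) : ∃ e ∈ S, u ∈ e ∧ e ≠ e₀ ∧ incEdge emb f e := by
  by_contra! hcon
  obtain ⟨a, ha⟩ := hf.nonempty
  obtain ⟨b, hb⟩ := openArc_nonempty (emb := emb) (hS he₁)
  set W : Set V := {w | w ≠ u ∧ emb.pos w ∈ emb.draw S}
  set K := emb.draw {e ∈ S | u ∉ e} ∪ emb.pos '' W with hK
  have hsub : {e ∈ S | u ∉ e} ⊆ G.edgeSet := fun e he => hS he.1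
  have hKc : IsCompact K := (isCompact_draw hsub).union ((W.toFinite.image _).isCompact)
  have hKD : K ⊆ emb.draw S := by
    refine Set.union_subset (draw_mono fun e he => he.1) ?_
    rintro _ ⟨w, hw, rfl⟩
    exact hw.2
  have huK : emb.pos u ∉ K := by
    rintro (h | ⟨w, hw, hwu⟩)
    · obtain ⟨e, he, hue⟩ := (pos_mem_draw hsub).1 h
      exact he.2 hue
    · exact hw.1 (emb.pos_injective hwu)
  have hf' := hf.of_closure_inter_subset (isClosed_draw hS) (D₀ := K ∪ arcSet emb e₀) ?_
    (Set.union_subset hKD (arcSet_subset_draw he₀))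
  · have hbK : Disjoint (emb.openArc e₁) K := by
      refine Set.disjoint_union_right.2 ⟨disjoint_openArc_draw (hS he₁) hsub fun h => h.2 hu₁, ?_⟩
      refine Set.disjoint_left.2 ?_
      rintro _ hz ⟨w, hw, rfl⟩
      exact pos_notMem_openArc (hS he₁) hz
    have h1 : LinkedOff K a b :=
      (LinkedOff.of_mem_closure hf.isPreconnected (hf.disjoint.mono_right hKD) ha hu huK).trans
        (LinkedOff.of_mem_closure (isPreconnected_openArc (hS he₁)) hbK hb
          (arcSet_subset_closure_openArc (hS he₁) ((pos_mem_arcSet (hS he₁)).2 hu₁)) huK).symm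
    have h2 : LinkedOff (arcSet emb e₀) a b := by
      refine linkedOff_arcSet (hS he₀) (fun h => ?_) (fun h => ?_)
      · exact Set.disjoint_left.1 hf.disjoint ha (arcSet_subset_draw he₀ h)
      · obtain ⟨w, -, -, rfl⟩ := arcSet_inter_arcSet (hS he₁) (hS he₀) hne hb.1 h
        exact pos_notMem_openArc (hS he₁) hb
    have h3 : LinkedOff (K ∪ arcSet emb e₀) a b := by
      refine h1.union hKc (isCompact_arcSet (hS he₀)) ?_ h2
      obtain ⟨v, rfl⟩ := hu₀
      refine (Set.subsingleton_of_subset_singleton (a := emb.pos v) ?_).isPreconnected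
      have key : ∀ w, w ≠ u → emb.pos w ∈ arcSet emb s(u, v) → emb.pos w = emb.pos v := by
        intro w hw h
        rcases Sym2.mem_iff.1 ((pos_mem_arcSet (hS he₀)).1 h) with rfl | rfl
        · exact absurd rfl hw
        · rfl
      rintro z ⟨hz | ⟨w, hw, rfl⟩, hz'⟩
      · obtain ⟨e, he, hz⟩ := mem_draw.1 hz
        obtain ⟨w, hw, -, rfl⟩ := arcSet_inter_arcSet (hS he.1) (hS he₀)
          (fun h => he.2 (by simp [h])) hz hz'
        exact key w (fun h => he.2 (h ▸ hw)) hz'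
      · exact key w hw.1 hz'
    exact Set.disjoint_left.1 hf.disjoint (hf'.mem_of_linkedOff ha h3)
      (arcSet_subset_draw he₁ hb.1)
  · rintro z ⟨hz, hzD⟩
    obtain ⟨e, he, hze⟩ := mem_draw.1 hzD
    by_cases hue : u ∈ e
    · by_cases hee : e = e₀
      · exact Or.inr (hee ▸ hze)
      by_cases hzo : z ∈ emb.openArc e
      · exact absurd (incEdge_of_mem_openArc hS hf he hzo hz) (hcon e he hue hee)
      · obtain ⟨w, hw, rfl⟩ : z ∈ emb.pos '' {w | w ∈ e} := by
          by_contra h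
          exact hzo ⟨hze, h⟩
        by_cases hwu : w = u
        · exact Or.inr ((pos_mem_arcSet (hS he₀)).2 (hwu ▸ hu₀))
        · exact Or.inl (Or.inr ⟨w, ⟨hwu, hzD⟩, rfl⟩)
    · exact Or.inl (Or.inl (mem_draw.2 ⟨e, ⟨he, hue⟩, hze⟩))

omit [Finite V] in
/-- Two connected sets with a common edge on their closures are linked after erasing it. -/
lemma linkedOff_diff_of_incEdge (hS : S ⊆ G.edgeSet) (he : e ∈ G.edgeSet) (heS : e ∉ S)
    (h₁ : IsPreconnected f₁) (h₂ : IsPreconnected f₂) (hd₁ : Disjoint f₁ (emb.draw S))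
    (hd₂ : Disjoint f₂ (emb.draw S)) (hi₁ : incEdge emb f₁ e) (hi₂ : incEdge emb f₂ e)
    {a b : ℝ × ℝ} (ha : a ∈ f₁) (hb : b ∈ f₂) : LinkedOff (emb.draw S) a b := by
  obtain ⟨z, hz⟩ := openArc_nonempty (emb := emb) he
  have hzS := Set.disjoint_left.1 (disjoint_openArc_draw he hS heS) hz
  exact (LinkedOff.of_mem_closure h₁ hd₁ ha (hi₁ hz.1) hzS).trans
    (LinkedOff.of_mem_closure h₂ hd₂ hb (hi₂ hz.1) hzS).symm

/-- An edge is incident with at most two faces. -/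
lemma faces_of_edge (hS : S ⊆ G.edgeSet) (he : e ∈ S) (h₁ : IsFaceOf (emb.draw S) f₁)
    (h₂ : IsFaceOf (emb.draw S) f₂) (h₃ : IsFaceOf (emb.draw S) f₃) (hi₁ : incEdge emb f₁ e)
    (hi₂ : incEdge emb f₂ e) (hi₃ : incEdge emb f₃ e) : f₁ = f₂ ∨ f₁ = f₃ ∨ f₂ = f₃ := by
  obtain ⟨a, ha⟩ := h₁.nonempty
  obtain ⟨b, hb⟩ := h₂.nonempty
  obtain ⟨c, hc⟩ := h₃.nonempty
  have hK : S \ {e} ⊆ G.edgeSet := Set.sdiff_subset.trans hS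
  have hKD : emb.draw (S \ {e}) ⊆ emb.draw S := draw_mono Set.sdiff_subset
  have hab := linkedOff_diff_of_incEdge hK (hS he) (by simp) h₁.isPreconnected h₂.isPreconnected
    (h₁.disjoint.mono_right hKD) (h₂.disjoint.mono_right hKD) hi₁ hi₂ ha hb
  have hac := linkedOff_diff_of_incEdge hK (hS he) (by simp) h₁.isPreconnected h₃.isPreconnected
    (h₁.disjoint.mono_right hKD) (h₃.disjoint.mono_right hKD) hi₁ hi₃ ha hc
  have heD := arcSet_subset_draw (emb := emb) he
  have hdis := disjoint_openArc_draw (emb := emb) (hS he) hK (by simp)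
  have haA : a ∉ arcSet emb e := fun h => Set.disjoint_left.1 h₁.disjoint ha (heD h)
  have hbA : b ∉ arcSet emb e := fun h => Set.disjoint_left.1 h₂.disjoint hb (heD h)
  have hcA : c ∉ arcSet emb e := fun h => Set.disjoint_left.1 h₃.disjoint hc (heD h)
  have key : LinkedOff (emb.draw S) a b ∨ LinkedOff (emb.draw S) a c ∨
      LinkedOff (emb.draw S) b c := by
    rw [← draw_diff_union he]
    have heG := hS he
    have hKc := isCompact_draw (emb := emb) hK
    generalize emb.draw (S \ {e}) = K at *
    induction e with | _ u v
    obtain ⟨γ, hγ, hi, h0, h1, h2⟩ := emb.exists_curve (G.mem_edgeSet.1 heG)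
    rw [openArc_eq_image hi h0 h1 h2] at hdis
    rw [← h2] at haA hbA hcA ⊢
    refine linkedOff_union_arc hKc hγ hi ?_ haA hbA hcA hab hac
    rintro _ ⟨hy, t, ht, rfl⟩
    by_contra hne
    simp only [Set.mem_insert_iff, Set.mem_singleton_iff, not_or] at hne
    refine Set.disjoint_left.1 hdis ⟨t, ⟨lt_of_le_of_ne ht.1 ?_, lt_of_le_of_ne ht.2 ?_⟩, rfl⟩ hy
    · rintro rfl; exact hne.1 rfl
    · rintro rfl; exact hne.2 rfl
  exact key.imp (h₁.eq_of_linkedOff h₂ ha hb)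
    (Or.imp (h₁.eq_of_linkedOff h₃ ha hc) (h₂.eq_of_linkedOff h₃ hb hc))

end Faces

section Cycles

variable {V : Type*} {G : SimpleGraph V}

/-- A closed sequence of distinct consecutively adjacent vertices forms a cycle. -/
lemma exists_isCycle_of_seq {n : ℕ} (hn : 2 ≤ n) {q : ℕ → V} (hq : Set.InjOn q (Set.Iic n))
    (hadj : ∀ i < n, G.Adj (q i) (q (i + 1))) (hclose : G.Adj (q n) (q 0)) :
    ∃ C : G.Walk (q n) (q n), C.IsCycle ∧ C.length = n + 1 ∧ ∀ i ≤ n, q i ∈ C.support := by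
  have key : ∀ m ≤ n, ∃ w : G.Walk (q 0) (q m), w.IsPath ∧ w.length = m ∧
      (∀ v, v ∈ w.support ↔ ∃ i ≤ m, q i = v) ∧
      ∀ e, e ∈ w.edges → ∃ i < m, e = s(q i, q (i + 1)) := by
    intro m hm
    induction m with
    | zero => exact ⟨.nil, by simp, rfl, by simp [eq_comm], by simp⟩
    | succ m ih =>
      obtain ⟨w, h1, h2, h3, h4⟩ := ih (by lia)
      refine ⟨w.concat (hadj m hm), h1.concat ?_ _, by simp [h2], fun v => ?_, fun e he => ?_⟩
      · rw [h3]
        rintro ⟨i, hi, h⟩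
        have := hq (by simp; lia) (by simp; lia) h
        lia
      · rw [SimpleGraph.Walk.support_concat, List.mem_append, h3, List.mem_singleton]
        constructor
        · rintro (⟨i, hi, rfl⟩ | rfl)
          · exact ⟨i, by lia, rfl⟩
          · exact ⟨m + 1, le_rfl, rfl⟩
        · rintro ⟨i, hi, rfl⟩
          rcases Nat.le_succ_iff.1 hi with h | rfl
          · exact Or.inl ⟨i, h, rfl⟩
          · exact Or.inr rfl
      · rw [SimpleGraph.Walk.edges_concat, List.concat_eq_append, List.mem_append,
          List.mem_singleton] at he
        rcases he with he | rfl
        · obtain ⟨i, hi, h⟩ := h4 e he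
          exact ⟨i, by lia, h⟩
        · exact ⟨m, by lia, rfl⟩
  obtain ⟨w, h1, h2, h3, h4⟩ := key n le_rfl
  refine ⟨.cons hclose w, (SimpleGraph.Walk.cons_isCycle_iff _ _).2 ⟨h1, fun h => ?_⟩,
    by simp [h2], fun i hi => ?_⟩
  · obtain ⟨i, hi, h⟩ := h4 _ h
    rcases Sym2.eq_iff.1 h with ⟨h5, h6⟩ | ⟨h5, h6⟩
    · have := hq (by simp) (by simp; lia) h5
      lia
    · have h7 := hq (by simp) (by simp; lia) h5
      have h8 := hq (by simp) (by simp; lia) h6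
      lia
  · rw [SimpleGraph.Walk.support_cons]
    exact List.mem_cons_of_mem _ ((h3 _).2 ⟨i, hi, rfl⟩)

/-- A periodic enumeration of the vertices of a cycle in cyclic order. -/
structure IsCyclicParam {x : V} (C : G.Walk x x) (p : ℤ → V) : Prop where
  eq_iff : ∀ i j, p i = p j ↔ (C.length : ℤ) ∣ i - j
  mem_support : ∀ v, v ∈ C.support ↔ ∃ i, p i = v
  mem_edges : ∀ e, e ∈ C.edges ↔ ∃ i, s(p i, p (i + 1)) = e

lemma exists_isCyclicParam {x : V} {C : G.Walk x x} (hC : C.IsCycle) :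
    ∃ p : ℤ → V, IsCyclicParam C p := by
  have hpos : 0 < C.length := by
    have := hC.three_le_length
    lia
  have hpos' : (0 : ℤ) < C.length := by exact_mod_cast hpos
  set p : ℤ → V := fun i => C.getVert (i % C.length).toNat with hp
  have hval : ∀ k : ℕ, k ≤ C.length → p k = C.getVert k := by
    intro k hk
    rcases hk.lt_or_eq with h | rfl
    · simp only [hp]
      rw [Int.emod_eq_of_lt (by positivity) (by exact_mod_cast h), Int.toNat_natCast]
    · simp [hp]
  have hper : ∀ i j, (C.length : ℤ) ∣ i - j → p i = p j := by
    intro i j h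
    simp only [hp]
    rw [Int.emod_emod_of_dvd _ dvd_rfl |>.symm, (Int.emod_emod_of_dvd j dvd_rfl).symm,
      Int.emod_emod_of_dvd _ dvd_rfl, Int.emod_emod_of_dvd _ dvd_rfl,
      Int.emod_eq_emod_iff_emod_sub_eq_zero.2 (Int.emod_eq_zero_of_dvd h)]
  have hred : ∀ i : ℤ, ∃ k < C.length, (C.length : ℤ) ∣ i - (k : ℕ) := by
    intro i
    have h1 := Int.emod_nonneg i hpos'.ne'
    have h2 := Int.emod_lt_of_pos i hpos'
    refine ⟨(i % C.length).toNat, by lia, ?_⟩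
    rw [Int.toNat_of_nonneg h1]
    exact Int.dvd_self_sub_emod
  refine ⟨p, fun i j => ⟨fun h => ?_, hper i j⟩, fun v => ?_, fun e => ?_⟩
  · obtain ⟨k, hk, hik⟩ := hred i
    obtain ⟨l, hl, hjl⟩ := hred j
    rw [hper _ _ hik, hper _ _ hjl, hval _ hk.le, hval _ hl.le] at h
    have hkl : k = l := hC.getVert_injOn' (by simp; lia) (by simp; lia) h
    subst hkl
    have := dvd_sub hik hjl
    simpa using this
  · rw [SimpleGraph.Walk.mem_support_iff_exists_getVert]
    constructor
    · rintro ⟨k, rfl, hk⟩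
      exact ⟨k, hval k hk⟩
    · rintro ⟨i, rfl⟩
      obtain ⟨k, hk, hik⟩ := hred i
      exact ⟨k, by rw [hper _ _ hik, hval _ hk.le], hk.le⟩
  · have hval' : ∀ k : ℕ, k < C.length → p ((k : ℤ) + 1) = C.getVert (k + 1) := by
      intro k hk
      exact_mod_cast hval (k + 1) hk
    induction e with | _ u v
    rw [← SimpleGraph.Walk.adj_toSubgraph_iff_mem_edges, SimpleGraph.Walk.toSubgraph_adj_iff]
    constructor
    · rintro ⟨k, h, hk⟩
      exact ⟨k, by rw [hval _ hk.le, hval' _ hk, h]⟩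
    · rintro ⟨i, h⟩
      obtain ⟨k, hk, hik⟩ := hred i
      refine ⟨k, ?_, hk⟩
      rw [← h, hper _ _ hik, hper (i + 1) (k + 1) (by simpa using hik), hval _ hk.le, hval' _ hk]

namespace IsCyclicParam

variable {x : V} {C : G.Walk x x} {p : ℤ → V} (hp : IsCyclicParam C p)
include hp

lemma add_length (i : ℤ) : p (i + C.length) = p i := (hp.eq_iff _ _).2 (by simp)

lemma ne {i j : ℤ} (h : i < j) (h' : j < i + C.length) : p i ≠ p j := fun h'' => by
  have h1 := (hp.eq_iff _ _).1 h''.symm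
  have := Int.le_of_dvd (by lia) h1
  lia

lemma mem_supp (i : ℤ) : p i ∈ C.support := (hp.mem_support _).2 ⟨i, rfl⟩

lemma edge_mem (i : ℤ) : s(p i, p (i + 1)) ∈ C.edges := (hp.mem_edges _).2 ⟨i, rfl⟩

lemma adj (i : ℤ) : G.Adj (p i) (p (i + 1)) := C.adj_of_mem_edges (hp.edge_mem i)

/-- Every vertex of the cycle occurs in each window of `C.length` consecutive indices. -/
lemma exists_window (hpos : 0 < C.length) (i₀ : ℤ) {v : V} (hv : v ∈ C.support) :
    ∃ k : ℤ, 0 ≤ k ∧ k < C.length ∧ p (i₀ + k) = v := by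
  obtain ⟨j, rfl⟩ := (hp.mem_support v).1 hv
  have hpos' : (0 : ℤ) < C.length := by exact_mod_cast hpos
  refine ⟨(j - i₀) % C.length, Int.emod_nonneg _ hpos'.ne', Int.emod_lt_of_pos _ hpos', ?_⟩
  rw [hp.eq_iff, show i₀ + (j - i₀) % C.length - j = -((j - i₀) - (j - i₀) % C.length) by ring]
  exact (dvd_neg.2 Int.dvd_self_sub_emod)

lemma exists_window_edge (hpos : 0 < C.length) (i₀ : ℤ) {e : Sym2 V} (he : e ∈ C.edges) :
    ∃ k : ℤ, 0 ≤ k ∧ k < C.length ∧ s(p (i₀ + k), p (i₀ + k + 1)) = e := by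
  obtain ⟨j, rfl⟩ := (hp.mem_edges e).1 he
  obtain ⟨k, h0, h1, h2⟩ := hp.exists_window hpos i₀ (hp.mem_supp j)
  have := (hp.eq_iff _ _).1 h2
  exact ⟨k, h0, h1, by rw [h2, (hp.eq_iff (i₀ + k + 1) (j + 1)).2 (by simpa using this)]⟩

lemma edge_eq_iff (h3 : 3 ≤ C.length) {i j : ℤ} :
    s(p i, p (i + 1)) = s(p j, p (j + 1)) ↔ (C.length : ℤ) ∣ i - j := by
  constructor
  · intro h
    rcases Sym2.eq_iff.1 h with ⟨h1, -⟩ | ⟨h1, h2⟩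
    · exact (hp.eq_iff _ _).1 h1
    · rw [hp.eq_iff] at h1 h2
      have h4 := dvd_sub h1 h2
      rw [show i - (j + 1) - (i + 1 - j) = -2 by lia, dvd_neg] at h4
      have := Int.le_of_dvd (by lia) h4
      lia
  · intro h
    rw [(hp.eq_iff i j).2 h, (hp.eq_iff (i + 1) (j + 1)).2 (by simpa using h)]

lemma edge_ne (h3 : 3 ≤ C.length) {i j : ℤ} (h : i < j) (h' : j < i + C.length) :
    s(p i, p (i + 1)) ≠ s(p j, p (j + 1)) := fun h'' => by
  have h1 := (hp.edge_eq_iff h3).1 h''.symm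
  have := Int.le_of_dvd (by lia) h1
  lia

lemma mem_edge_iff (h3 : 3 ≤ C.length) {i : ℤ} {e : Sym2 V} (he : e ∈ C.edges) :
    p i ∈ e ↔ e = s(p (i - 1), p i) ∨ e = s(p i, p (i + 1)) := by
  constructor
  · obtain ⟨j, rfl⟩ := (hp.mem_edges e).1 he
    intro h
    rcases Sym2.mem_iff.1 h with h | h
    · right
      rw [hp.edge_eq_iff h3]
      rw [hp.eq_iff] at h
      exact (dvd_sub_comm).1 h
    · left
      have := hp.edge_eq_iff h3 (i := j) (j := i - 1)
      rw [sub_add_cancel] at this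
      rw [this]
      rw [hp.eq_iff] at h
      rw [show j - (i - 1) = j + 1 - i by ring]
      exact dvd_sub_comm.1 h
  · rintro (rfl | rfl) <;> simp

end IsCyclicParam

variable [Fintype V] {x : V} {C : G.Walk x x} {p : ℤ → V}

lemma IsLongestIsolatingCycle.false_of_seq (hC : IsLongestIsolatingCycle G C)
    {q : ℕ → V} (hq : Set.InjOn q (Set.Iic C.length))
    (hadj : ∀ i < C.length, G.Adj (q i) (q (i + 1))) (hclose : G.Adj (q C.length) (q 0))
    (hsupp : ∀ v ∈ C.support, ∃ i ≤ C.length, q i = v) : False := by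
  obtain ⟨C', h1, h2, h3⟩ := exists_isCycle_of_seq
    (by have := hC.1.three_le_length; lia) hq hadj hclose
  have hsub : ∀ v ∈ C.support, v ∈ C'.support := by
    intro v hv
    obtain ⟨i, hi, rfl⟩ := hsupp v hv
    exact h3 i hi
  have := hC.2.2 _ C' h1 fun v hv => ?_
  · lia
  · obtain ⟨h4, h5⟩ := hC.2.1 v fun h => hv (hsub v h)
    exact ⟨h4, fun w hw => hsub w (h5 w hw)⟩

/-- A longest isolating cycle has no extendable edge. -/
lemma IsLongestIsolatingCycle.not_extendable (hC : IsLongestIsolatingCycle G C)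
    (hp : IsCyclicParam C p) {i : ℤ} {v : V} (hv : v ∉ C.support) (h1 : G.Adj v (p i))
    (h2 : G.Adj v (p (i + 1))) : False := by
  have h3 := hC.1.three_le_length
  refine hC.false_of_seq (q := fun k => if k = 0 then v else p (i + k)) ?_ ?_ ?_ ?_
  · intro k hk l hl h
    simp only [Set.mem_Iic] at hk hl
    by_contra hne
    wlog hkl : k < l generalizing k l
    · exact this h.symm hl hk (Ne.symm hne) (by lia)
    have hl0 : l ≠ 0 := by lia
    simp only [hl0, if_false] at h
    split_ifs at h with hk0
    · exact hv (h ▸ hp.mem_supp _)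
    · exact hp.ne (by lia) (by lia) h
  · intro k hk
    rcases Nat.eq_zero_or_pos k with rfl | h
    · simpa using h2
    · have := hp.adj (i + k)
      simp only [h.ne', if_false, Nat.add_eq_zero_iff, false_and]
      push_cast
      rwa [← add_assoc]
  · simpa [show C.length ≠ 0 by lia, hp.add_length] using h1.symm
  · intro u hu
    obtain ⟨k, h4, h5, rfl⟩ := hp.exists_window (by lia) (i + 1) hu
    refine ⟨k.toNat + 1, by lia, ?_⟩
    simp only [Nat.add_eq_zero_iff, one_ne_zero, and_false, if_false]
    congr 1
    lia

/-- A short chord next to a vertex that is bypassed by a vertex off the cycle yields a longer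
isolating cycle. -/
lemma IsLongestIsolatingCycle.not_bypass (hC : IsLongestIsolatingCycle G C) (h8 : 8 ≤ C.length)
    (hp : IsCyclicParam C p) {i : ℤ} {v : V} (hv : v ∉ C.support) (h1 : G.Adj v (p (i - 1)))
    (h2 : G.Adj v (p (i + 1))) (h3 : G.Adj (p i) (p (i + 2))) : False := by
  refine hC.false_of_seq (q := fun k => if k = 0 then v else if k = 1 then p (i + 1) else
    if k = 2 then p i else p (i + k - 1)) ?_ ?_ ?_ ?_
  · intro k hk l hl h
    simp only [Set.mem_Iic] at hk hl
    by_contra hne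
    wlog hkl : k < l generalizing k l
    · exact this h.symm hl hk (Ne.symm hne) (by lia)
    dsimp only at h
    split_ifs at h
    all_goals first
      | lia
      | exact hv (h ▸ hp.mem_supp _)
      | exact hp.ne (by lia) (by lia) h
      | exact hp.ne (by lia) (by lia) h.symm
  · intro k hk
    rcases (by lia : k = 0 ∨ k = 1 ∨ k = 2 ∨ 3 ≤ k) with rfl | rfl | rfl | h
    · simpa using h2
    · simpa using (hp.adj i).symm
    · simpa [show i + 3 - 1 = i + 2 by ring] using h3
    · have := hp.adj (i + k - 1)
      simp only [show k ≠ 0 by lia, show k ≠ 1 by lia, show k ≠ 2 by lia, show k + 1 ≠ 0 by lia,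
        show k + 1 ≠ 1 by lia, show k + 1 ≠ 2 by lia, if_false]
      push_cast
      rwa [show i + (k + 1) - 1 = i + (k : ℤ) - 1 + 1 by ring]
  · have := hp.add_length (i - 1)
    rw [show i - 1 + (C.length : ℤ) = i + C.length - 1 by ring] at this
    simp only [show C.length ≠ 0 by lia, show C.length ≠ 1 by lia, show C.length ≠ 2 by lia,
      if_false, if_true, this]
    exact h1.symm
  · intro u hu
    obtain ⟨k, h4, h5, rfl⟩ := hp.exists_window (by lia) i hu
    rcases (by lia : k = 0 ∨ k = 1 ∨ 2 ≤ k) with rfl | rfl | h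
    · exact ⟨2, by lia, by simp⟩
    · exact ⟨1, by lia, by simp⟩
    · refine ⟨k.toNat + 1, by lia, ?_⟩
      simp only [show k.toNat + 1 ≠ 0 by lia, show k.toNat + 1 ≠ 1 by lia,
        show k.toNat + 1 ≠ 2 by lia, if_false]
      congr 1
      lia

end Cycles

section ThreeConnected

variable {V : Type*} [Fintype V] {G : SimpleGraph V}

lemma ThreeConnected.exists_adj_ne (h : ThreeConnected G) (u a b : V) :
    ∃ t, G.Adj u t ∧ t ≠ a ∧ t ≠ b := by
  set S : Finset V := ({a, b} : Finset V).erase u with hS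
  have hcard : S.card ≤ 2 := (Finset.card_le_card (Finset.erase_subset _ _)).trans
    Finset.card_le_two
  have hconn := h.2 S hcard
  obtain ⟨t, ht⟩ : ∃ t, t ∉ insert u S := by
    by_contra! hcon
    have h1 : Finset.univ ⊆ insert u S := fun t _ => hcon t
    have h2 := Finset.card_le_card h1
    have h3 := Finset.card_insert_le u S
    have h4 := h.1
    rw [Finset.card_univ] at h2
    lia
  rw [Finset.mem_insert, not_or] at ht
  have : Nontrivial ((S : Set V)ᶜ : Set V) :=
    ⟨⟨u, by simp [hS]⟩, ⟨t, by simpa using ht.2⟩, fun h => ht.1 (congrArg Subtype.val h).symm⟩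
  obtain ⟨⟨w, hw⟩, hadj⟩ := hconn.preconnected.exists_adj_of_nontrivial ⟨u, by simp [hS]⟩
  have huw : G.Adj u w := hadj
  have hwu : w ≠ u := huw.ne'
  have hwS : w ∉ S := by simpa using hw
  simp only [hS, Finset.mem_erase, Finset.mem_insert, Finset.mem_singleton] at hwS
  exact ⟨w, huw, by tauto, by tauto⟩

end ThreeConnected

section Arcs

variable {V : Type*} {G : SimpleGraph V} {emb : PlaneEmbedding G} {x : V} {C : G.Walk x x}
  {p : ℤ → V}

/-- The `n` consecutive edges of the cyclic sequence `p` starting at index `i`. -/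
def arcEdges (p : ℤ → V) (i : ℤ) (n : ℕ) : Set (Sym2 V) :=
  (fun j => s(p j, p (j + 1))) '' Set.Ico i (i + n)

lemma mem_arcEdges {i : ℤ} {n : ℕ} {e : Sym2 V} :
    e ∈ arcEdges p i n ↔ ∃ j, i ≤ j ∧ j < i + n ∧ s(p j, p (j + 1)) = e := by
  simp [arcEdges, and_assoc]

lemma exists_mem_arcEdges {i j : ℤ} {n : ℕ} (hn : 0 < n) (h : i ≤ j) (h' : j ≤ i + n) :
    ∃ e ∈ arcEdges p i n, p j ∈ e := by
  rcases h'.lt_or_eq with h' | rfl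
  · exact ⟨_, ⟨j, ⟨h, h'⟩, rfl⟩, by simp⟩
  · exact ⟨_, ⟨i + n - 1, ⟨by lia, by lia⟩, rfl⟩, by simp⟩

namespace IsCyclicParam

variable (hp : IsCyclicParam C p)
include hp

lemma arcEdges_subset (i : ℤ) (n : ℕ) : arcEdges p i n ⊆ {e | e ∈ C.edges} := by
  rintro _ ⟨j, -, rfl⟩
  exact hp.edge_mem j

lemma arcEdges_subset_edgeSet (i : ℤ) (n : ℕ) : arcEdges p i n ⊆ G.edgeSet :=
  fun _ he => C.edges_subset_edgeSet (hp.arcEdges_subset i n he)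

lemma isPreconnected_insert_arc (i : ℤ) (n : ℕ) :
    IsPreconnected (insert (emb.pos (p i)) (emb.draw (arcEdges p i n))) ∧
      emb.pos (p (i + n)) ∈ insert (emb.pos (p i)) (emb.draw (arcEdges p i n)) := by
  induction n with
  | zero => simp [arcEdges, draw, isPreconnected_singleton]
  | succ n ih =>
    have h1 : arcEdges p i (n + 1) = insert s(p (i + n), p (i + n + 1)) (arcEdges p i n) := by
      have h2 : Set.Ico i (i + ↑(n + 1)) = insert (i + (n : ℤ)) (Set.Ico i (i + n)) := by
        ext j
        simp only [Set.mem_Ico, Set.mem_insert_iff]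
        lia
      rw [arcEdges, h2, Set.image_insert_eq]
      rfl
    have he : s(p (i + n), p (i + n + 1)) ∈ G.edgeSet := hp.adj _
    have h2 : insert (emb.pos (p i)) (emb.draw (arcEdges p i (n + 1))) =
        insert (emb.pos (p i)) (emb.draw (arcEdges p i n)) ∪
          arcSet emb s(p (i + n), p (i + n + 1)) := by
      rw [h1, draw_insert, Set.insert_union, Set.union_comm]
    rw [h2]
    refine ⟨ih.1.union _ ih.2 ((pos_mem_arcSet he).2 (by simp)) (isPreconnected_arcSet he), ?_⟩
    exact Or.inr ((pos_mem_arcSet he).2 (by push_cast; rw [← add_assoc]; simp))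

lemma isPreconnected_arc (i : ℤ) (n : ℕ) : IsPreconnected (emb.draw (arcEdges p i n)) := by
  rcases Nat.eq_zero_or_pos n with rfl | hn
  · simp [arcEdges, draw, isPreconnected_empty]
  · have h : emb.pos (p i) ∈ emb.draw (arcEdges p i n) :=
      (pos_mem_draw (hp.arcEdges_subset_edgeSet i n)).2
        ⟨_, ⟨i, by simpa using hn, rfl⟩, by simp⟩
    simpa [Set.insert_eq_of_mem h] using (hp.isPreconnected_insert_arc (emb := emb) i n).1

lemma edges_diff_singleton (h3 : 3 ≤ C.length) (i : ℤ) :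
    {e | e ∈ C.edges} \ {s(p i, p (i + 1))} = arcEdges p (i + 1) (C.length - 1) := by
  ext e
  rw [mem_arcEdges]
  constructor
  · rintro ⟨he, hne⟩
    obtain ⟨k, h0, h1, rfl⟩ := hp.exists_window_edge (by lia) i he
    have : k ≠ 0 := by
      rintro rfl
      exact hne (by simp)
    exact ⟨i + k, by lia, by lia, rfl⟩
  · rintro ⟨j, h1, h2, rfl⟩
    exact ⟨hp.edge_mem j, (hp.edge_ne h3 (by lia) (by lia)).symm⟩

lemma edges_diff_pair (h3 : 3 ≤ C.length) (i : ℤ) :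
    {e | e ∈ C.edges} \ {s(p (i - 1), p i), s(p i, p (i + 1))} =
      arcEdges p (i + 1) (C.length - 2) := by
  have hl : s(p (i - 1), p i) = s(p (i + C.length - 1), p (i + C.length - 1 + 1)) := by
    have h1 : p (i + C.length - 1) = p (i - 1) := (hp.eq_iff _ _).2 ⟨1, by ring⟩
    have h2 : p (i + C.length - 1 + 1) = p i := (hp.eq_iff _ _).2 ⟨1, by ring⟩
    rw [h1, h2]
  ext e
  rw [mem_arcEdges]
  constructor
  · rintro ⟨he, hne⟩
    obtain ⟨k, h0, h1, rfl⟩ := hp.exists_window_edge (by lia) i he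
    simp only [Set.mem_insert_iff, Set.mem_singleton_iff, not_or] at hne
    have : k ≠ 0 := by
      rintro rfl
      exact hne.2 (by simp)
    have : k ≠ C.length - 1 := by
      rintro rfl
      refine hne.1 ?_
      rw [hl, add_sub_assoc]
    exact ⟨i + k, by lia, by lia, rfl⟩
  · rintro ⟨j, h1, h2, rfl⟩
    refine ⟨hp.edge_mem j, ?_⟩
    rintro (h | h)
    · exact hp.edge_ne h3 (by lia) (by lia) (h.trans hl)
    · exact hp.edge_ne h3 (by lia) (by lia) h.symm

end IsCyclicParam

end Arcs

section FacesOfH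

variable {V : Type*} [Fintype V] {G : SimpleGraph V} {emb : PlaneEmbedding G} {x : V}
  {C : G.Walk x x} {p : ℤ → V} {e : Sym2 V} {f g h : Set (ℝ × ℝ)} {i : ℤ}

omit [Fintype V] in
lemma Hgraph_edgeSet_subset : (Hgraph C).edgeSet ⊆ G.edgeSet :=
  SimpleGraph.edgeSet_mono (SimpleGraph.deleteEdges_le _)

omit [Fintype V] in
lemma mem_Hgraph_edgeSet : e ∈ (Hgraph C).edgeSet ↔
    e ∈ G.edgeSet ∧ (e ∈ C.edges ∨ ∃ v ∈ e, v ∉ C.support) := by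
  rw [Hgraph, SimpleGraph.edgeSet_deleteEdges, Set.mem_sdiff, chordSet]
  simp only [Set.mem_ofPred_eq, not_and, not_forall]
  constructor
  · rintro ⟨h1, h2⟩
    refine ⟨h1, or_iff_not_imp_left.2 fun h3 => ?_⟩
    obtain ⟨v, h4, h5⟩ := h2 h1 h3
    exact ⟨v, h4, h5⟩
  · rintro ⟨h1, h2⟩
    refine ⟨h1, fun _ h3 => ?_⟩
    obtain ⟨v, h4, h5⟩ := h2.resolve_left h3
    exact ⟨v, h4, h5⟩

omit [Fintype V] in
lemma edges_subset_Hgraph : {e | e ∈ C.edges} ⊆ (Hgraph C).edgeSet := fun _ he =>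
  mem_Hgraph_edgeSet.2 ⟨C.edges_subset_edgeSet he, Or.inl he⟩

omit [Fintype V] in
lemma edges_subset_edgeSet : {e | e ∈ C.edges} ⊆ G.edgeSet := fun _ he =>
  C.edges_subset_edgeSet he

lemma mem_Vminus_union_Vplus {v : V} : v ∈ Vminus emb C ∪ Vplus emb C ↔ v ∉ C.support := by
  simp only [Vplus, Finset.mem_union, Finset.mem_filter, Finset.mem_univ, true_and]
  constructor
  · rintro (h | h)
    · exact (Finset.mem_filter.1 h).2.1
    · exact h.1
  · intro h
    by_cases h' : v ∈ Vminus emb C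
    · exact Or.inl h'
    · exact Or.inr ⟨h, h'⟩

lemma IsIsolating.exists_adj_ne (hC : IsIsolating G C) {v : V} (hv : v ∉ C.support) (u : V) :
    ∃ w ∈ C.support, G.Adj v w ∧ w ≠ u := by
  obtain ⟨h1, h2⟩ := hC v hv
  obtain ⟨w, hw, hwu⟩ := Finset.exists_mem_ne (by rw [h1]; norm_num) u
  rw [Finset.mem_filter] at hw
  exact ⟨w, h2 w hw.2, hw.2, hwu⟩

lemma drawingH_eq_draw (hC : IsIsolating G C) (hp : IsCyclicParam C p) :
    drawingH emb C = emb.draw (Hgraph C).edgeSet := by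
  ext z
  rw [mem_draw, drawingH, drawingOn]
  simp only [Set.image_univ, Set.mem_univ, Set.iUnion_true, Set.mem_union, Set.mem_range,
    Set.mem_iUnion, exists_prop]
  constructor
  · rintro (⟨v, rfl⟩ | ⟨u, v, h, hz⟩)
    · by_cases hv : v ∈ C.support
      · obtain ⟨i, rfl⟩ := (hp.mem_support v).1 hv
        exact ⟨_, edges_subset_Hgraph (hp.edge_mem i), (pos_mem_arcSet (hp.adj i)).2 (by simp)⟩
      · obtain ⟨w, -, hw, -⟩ := hC.exists_adj_ne hv v
        exact ⟨s(v, w), mem_Hgraph_edgeSet.2 ⟨hw, Or.inr ⟨v, by simp, hv⟩⟩,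
          (pos_mem_arcSet (e := s(v, w)) hw).2 (by simp)⟩
    · exact ⟨s(u, v), h, hz⟩
  · rintro ⟨e, he, hz⟩
    induction e with | _ u v
    exact Or.inr ⟨u, v, he, hz⟩

lemma MinorFaceH.isFaceOf (hf : MinorFaceH emb C f) (hC : IsIsolating G C)
    (hp : IsCyclicParam C p) : IsFaceOf (emb.draw (Hgraph C).edgeSet) f :=
  drawingH_eq_draw hC hp ▸ hf.1

lemma MinorFaceH.eq_of_incVertex (hf : MinorFaceH emb C f) {v w : V} (hv : v ∉ C.support)
    (hw : w ∉ C.support) (hv' : incVertex emb f v) (hw' : incVertex emb f w) : v = w :=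
  hf.2.unique ⟨mem_Vminus_union_Vplus.2 hv, hv'⟩ ⟨mem_Vminus_union_Vplus.2 hw, hw'⟩

lemma MinorFaceH.exists_incVertex (hf : MinorFaceH emb C f) :
    ∃ v, v ∉ C.support ∧ incVertex emb f v := by
  obtain ⟨v, ⟨h1, h2⟩, -⟩ := hf.2
  exact ⟨v, mem_Vminus_union_Vplus.1 h1, h2⟩

omit [Fintype V] in
lemma incVertex_of_incEdge (h : incEdge emb f e) (he : e ∈ G.edgeSet) {v : V} (hv : v ∈ e) :
    incVertex emb f v :=
  h ((pos_mem_arcSet he).2 hv)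

omit [Fintype V] in
lemma IsCyclicParam.prev_ne (hp : IsCyclicParam C p) (h3 : 3 ≤ C.length) (i : ℤ) :
    s(p (i - 1), p i) ≠ s(p i, p (i + 1)) := by
  have := hp.edge_ne h3 (i := i - 1) (j := i) (by lia) (by lia)
  rwa [sub_add_cancel] at this

omit [Fintype V] in
lemma IsCyclicParam.prev_mem (hp : IsCyclicParam C p) (i : ℤ) : s(p (i - 1), p i) ∈ C.edges := by
  simpa using hp.edge_mem (i - 1)

/-- A subface of a minor face that has a cycle vertex on its boundary is incident with a cycle
edge at this vertex. -/
lemma MinorFaceH.incEdge_of_incVertex (hf : MinorFaceH emb C f) (hp : IsCyclicParam C p)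
    (h3 : 3 ≤ C.length) {S : Set (Sym2 V)} (hS : S ⊆ G.edgeSet) (hCS : {e | e ∈ C.edges} ⊆ S)
    (hh : IsFaceOf (emb.draw S) h) (hhf : h ⊆ f) (hi : incVertex emb h (p i))
    (hSi : ∀ e ∈ S, p i ∈ e → e ∈ C.edges ∨ ∃ v ∈ e, v ∉ C.support) :
    incEdge emb h s(p (i - 1), p i) ∨ incEdge emb h s(p i, p (i + 1)) := by
  by_contra! hcon
  have hoff : ∀ e ∈ S, p i ∈ e → incEdge emb h e →
      ∃ v, v ∉ C.support ∧ e = s(p i, v) ∧ incVertex emb f v := by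
    intro e he hie hinc
    rcases hSi e he hie with h1 | ⟨v, hv, hvC⟩
    · rcases (hp.mem_edge_iff h3 h1).1 hie with rfl | rfl
      · exact absurd hinc hcon.1
      · exact absurd hinc hcon.2
    · refine ⟨v, hvC, ((Sym2.mem_and_mem_iff ?_).1 ⟨hie, hv⟩), closure_mono hhf
        (incVertex_of_incEdge hinc (hS he) hv)⟩
      rintro rfl
      exact hvC (hp.mem_supp i)
  have hl := hCS (hp.prev_mem i)
  have hr := hCS (hp.edge_mem i)
  have hil : p i ∈ s(p (i - 1), p i) := by simp
  have hir : p i ∈ s(p i, p (i + 1)) := by simp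
  obtain ⟨e, he, hie, -, hinc⟩ := exists_incEdge_ne hS hh hi hl hr hil hir (hp.prev_ne h3 i).symm
  obtain ⟨v, hv, rfl, hvf⟩ := hoff e he hie hinc
  obtain ⟨e', he', hie', hne, hinc'⟩ := exists_incEdge_ne hS hh hi he hr hie hir (by
    rintro h
    exact hcon.2 (h ▸ hinc))
  obtain ⟨v', hv', rfl, hvf'⟩ := hoff e' he' hie' hinc'
  exact hne (by rw [hf.eq_of_incVertex hv hv' hvf hvf'])

/-- A face of `H` that is incident with exactly one of the two cycle edges at a vertex is incident
with a neighbour of this vertex off the cycle. -/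
lemma exists_offCycle_adj (hf : IsFaceOf (emb.draw (Hgraph C).edgeSet) f)
    (hp : IsCyclicParam C p) (h3 : 3 ≤ C.length)
    (h : ¬ (incEdge emb f s(p (i - 1), p i) ↔ incEdge emb f s(p i, p (i + 1)))) :
    ∃ v, v ∉ C.support ∧ G.Adj v (p i) ∧ incVertex emb f v := by
  have key : ∀ e₀ e₁, e₀ ∈ C.edges → e₁ ∈ C.edges → p i ∈ e₀ → p i ∈ e₁ → e₁ ≠ e₀ →
      incEdge emb f e₀ → ¬ incEdge emb f e₁ →
      ∃ v, v ∉ C.support ∧ G.Adj v (p i) ∧ incVertex emb f v := by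
    intro e₀ e₁ he₀ he₁ h₀ h₁ hne hi₀ hi₁
    obtain ⟨e, he, hie, hne', hinc⟩ := exists_incEdge_ne Hgraph_edgeSet_subset hf
      (incVertex_of_incEdge hi₀ (edges_subset_edgeSet he₀) h₀) (edges_subset_Hgraph he₀)
      (edges_subset_Hgraph he₁) h₀ h₁ hne
    rcases (mem_Hgraph_edgeSet.1 he).2 with h1 | ⟨v, hv, hvC⟩
    · have h2 := (hp.mem_edge_iff h3 h1).1 hie
      have h3' := (hp.mem_edge_iff h3 he₀).1 h₀
      have h4 := (hp.mem_edge_iff h3 he₁).1 h₁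
      grind
    · have : e = s(p i, v) := (Sym2.mem_and_mem_iff (by
        rintro rfl
        exact hvC (hp.mem_supp i))).1 ⟨hie, hv⟩
      subst this
      exact ⟨v, hvC, (Hgraph_edgeSet_subset he : G.Adj _ _).symm,
        incVertex_of_incEdge hinc (Hgraph_edgeSet_subset he) hv⟩
  by_cases h1 : incEdge emb f s(p (i - 1), p i)
  · exact key _ _ (hp.prev_mem i) (hp.edge_mem i) (by simp) (by simp) (hp.prev_ne h3 i).symm h1
      (fun h2 => h ⟨fun _ => h2, fun _ => h1⟩)
  · refine key _ _ (hp.edge_mem i) (hp.prev_mem i) (by simp) (by simp) (hp.prev_ne h3 i) ?_ h1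
    by_contra h2
    exact h ⟨fun h => absurd h h1, fun h => absurd h h2⟩

/-- Two distinct faces of `H` with a common cycle edge lie on different sides of the cycle. -/
lemma not_linkedOff_drawC (hf : IsFaceOf (emb.draw (Hgraph C).edgeSet) f)
    (hg : IsFaceOf (emb.draw (Hgraph C).edgeSet) g) (hne : f ≠ g) (hp : IsCyclicParam C p)
    (h3 : 3 ≤ C.length) (hif : incEdge emb f s(p i, p (i + 1)))
    (hig : incEdge emb g s(p i, p (i + 1))) {a b : ℝ × ℝ} (ha : a ∈ f) (hb : b ∈ g) :
    ¬ LinkedOff (emb.draw {e | e ∈ C.edges}) a b := by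
  intro hab
  set e := s(p i, p (i + 1)) with he
  have heH : e ∈ (Hgraph C).edgeSet := edges_subset_Hgraph (hp.edge_mem i)
  have hsub : (Hgraph C).edgeSet \ {e} ⊆ G.edgeSet := Set.sdiff_subset.trans Hgraph_edgeSet_subset
  have hinter : {e | e ∈ C.edges} ∩ ((Hgraph C).edgeSet \ {e}) =
      arcEdges p (i + 1) (C.length - 1) := by
    rw [← hp.edges_diff_singleton h3, ← Set.inter_sdiff_assoc,
      Set.inter_eq_left.2 edges_subset_Hgraph]
  have hD : Disjoint f (emb.draw ((Hgraph C).edgeSet \ {e})) :=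
    hf.disjoint.mono_right (draw_mono Set.sdiff_subset)
  have hD' : Disjoint g (emb.draw ((Hgraph C).edgeSet \ {e})) :=
    hg.disjoint.mono_right (draw_mono Set.sdiff_subset)
  have h1 := linkedOff_diff_of_incEdge hsub (Hgraph_edgeSet_subset heH) (by simp)
    hf.isPreconnected hg.isPreconnected hD hD' hif hig ha hb
  have h2 := hab.union (isCompact_draw edges_subset_edgeSet) (isCompact_draw hsub) (by
    rw [draw_inter edges_subset_edgeSet hsub, hinter]
    · exact hp.isPreconnected_arc _ _
    · rintro w ⟨e', he', hw⟩ -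
      rw [hinter]
      obtain ⟨k, h0, h1, rfl⟩ := hp.exists_window (by lia) (i + 1)
        (C.mem_support_of_mem_edges he' hw)
      exact exists_mem_arcEdges (by lia) (by lia) (by lia)) h1
  refine hne (hf.eq_of_linkedOff hg ha hb (h2.mono ?_))
  rw [← draw_union]
  refine draw_mono fun e' he' => ?_
  by_cases h4 : e' = e
  · exact Or.inl (h4 ▸ hp.edge_mem i)
  · exact Or.inr ⟨he', h4⟩

/-- A vertex whose two cycle edges are incident with the same two faces of `H` has no neighbour
off the cycle. -/
lemma mem_support_of_adj_of_incEdge (hC : IsIsolating G C)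
    (hf : IsFaceOf (emb.draw (Hgraph C).edgeSet) f)
    (hg : IsFaceOf (emb.draw (Hgraph C).edgeSet) g) (hne : f ≠ g) (hp : IsCyclicParam C p)
    (h3 : 3 ≤ C.length) (hf₁ : incEdge emb f s(p (i - 1), p i))
    (hf₂ : incEdge emb f s(p i, p (i + 1))) (hg₁ : incEdge emb g s(p (i - 1), p i))
    (hg₂ : incEdge emb g s(p i, p (i + 1))) {v : V} (hv : G.Adj (p i) v) : v ∈ C.support := by
  by_contra hvC
  obtain ⟨a, ha⟩ := hf.nonempty
  obtain ⟨b, hb⟩ := hg.nonempty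
  set e₁ := s(p (i - 1), p i) with he₁
  set e₂ := s(p i, p (i + 1)) with he₂
  have hl : ∀ e ∈ C.edges, incEdge emb f e → incEdge emb g e →
      LinkedOff (emb.draw ((Hgraph C).edgeSet \ {e})) a b := fun e he h1 h2 =>
    linkedOff_diff_of_incEdge (Set.sdiff_subset.trans Hgraph_edgeSet_subset)
      (edges_subset_edgeSet he) (by simp) hf.isPreconnected hg.isPreconnected
      (hf.disjoint.mono_right (draw_mono Set.sdiff_subset))
      (hg.disjoint.mono_right (draw_mono Set.sdiff_subset)) h1 h2 ha hb
  have hinter : ((Hgraph C).edgeSet \ {e₁}) ∩ ((Hgraph C).edgeSet \ {e₂}) =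
      (Hgraph C).edgeSet \ {e₁, e₂} := by
    ext e
    simp only [Set.mem_inter_iff, Set.mem_sdiff, Set.mem_singleton_iff, Set.mem_insert_iff]
    tauto
  have hAsub : arcEdges p (i + 1) (C.length - 2) ⊆ (Hgraph C).edgeSet \ {e₁, e₂} := by
    rw [← hp.edges_diff_pair h3]
    exact Set.sdiff_subset_sdiff_left edges_subset_Hgraph
  have hoff : ∀ v w, v ∉ C.support → G.Adj v w → s(v, w) ∈ (Hgraph C).edgeSet \ {e₁, e₂} := by
    intro v w hv hvw
    refine ⟨mem_Hgraph_edgeSet.2 ⟨hvw, Or.inr ⟨v, by simp, hv⟩⟩, ?_⟩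
    rintro (h | h)
    · exact hv (C.mem_support_of_mem_edges (h ▸ hp.prev_mem i) (Sym2.mem_mk_left v w))
    · exact hv (C.mem_support_of_mem_edges (h ▸ hp.edge_mem i) (Sym2.mem_mk_left v w))
  have hwin : ∀ w ∈ C.support, w ≠ p i → ∃ e ∈ arcEdges p (i + 1) (C.length - 2), w ∈ e := by
    intro w hw hwi
    obtain ⟨k, h0, h1, rfl⟩ := hp.exists_window (by lia) i hw
    have : k ≠ 0 := by
      rintro rfl
      simp at hwi
    exact exists_mem_arcEdges (by lia) (by lia) (by lia)
  have hsubG : (Hgraph C).edgeSet \ {e₁, e₂} ⊆ G.edgeSet :=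
    Set.sdiff_subset.trans Hgraph_edgeSet_subset
  have hAG := hAsub.trans hsubG
  have hpre : IsPreconnected (emb.draw ((Hgraph C).edgeSet \ {e₁, e₂})) := by
    refine isPreconnected_of_forall (emb.pos (p (i + 1))) fun z hz => ?_
    have hx : emb.pos (p (i + 1)) ∈ emb.draw (arcEdges p (i + 1) (C.length - 2)) :=
      (pos_mem_draw hAG).2 (exists_mem_arcEdges (by lia) (by lia) (by lia))
    obtain ⟨e, he, hze⟩ := mem_draw.1 hz
    rcases (mem_Hgraph_edgeSet.1 he.1).2 with h1 | ⟨u, hu, huC⟩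
    · refine ⟨_, draw_mono hAsub, hx, mem_draw.2 ⟨e, ?_, hze⟩, hp.isPreconnected_arc _ _⟩
      rw [← hp.edges_diff_pair h3]
      exact ⟨h1, he.2⟩
    · obtain ⟨w, hwC, huw, hwi⟩ := hC.exists_adj_ne huC (p i)
      obtain ⟨e', he', hwe'⟩ := hwin w hwC hwi
      have h5 := isPreconnected_draw_insert (emb := emb) (e := s(u, w)) (w := w) huw hAG
        (hp.isPreconnected_arc _ _) (by simp) he' hwe'
      have h6 : insert s(u, w) (arcEdges p (i + 1) (C.length - 2)) ⊆
          (Hgraph C).edgeSet \ {e₁, e₂} := Set.insert_subset (hoff u w huC huw) hAsub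
      refine ⟨emb.draw (insert e (insert s(u, w) (arcEdges p (i + 1) (C.length - 2)))),
        draw_mono (Set.insert_subset he h6), ?_, ?_, ?_⟩
      · exact draw_mono (fun e he => Or.inr (Or.inr he)) hx
      · exact mem_draw.2 ⟨e, Or.inl rfl, hze⟩
      · exact isPreconnected_draw_insert (w := u) (hsubG he) (h6.trans hsubG) h5 hu (Or.inl rfl)
          (by simp)
  have hab := (hl e₁ (hp.prev_mem i) hf₁ hg₁).union
    (isCompact_draw (Set.sdiff_subset.trans Hgraph_edgeSet_subset))
    (isCompact_draw (Set.sdiff_subset.trans Hgraph_edgeSet_subset)) (by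
      rw [draw_inter (Set.sdiff_subset.trans Hgraph_edgeSet_subset)
        (Set.sdiff_subset.trans Hgraph_edgeSet_subset), hinter]
      · exact hpre
      · rintro w ⟨e, he, hw⟩ -
        rw [hinter]
        by_cases hwC : w ∈ C.support
        · by_cases hwi : w = p i
          · exact ⟨s(v, p i), hoff v (p i) hvC hv.symm, by simp [hwi]⟩
          · obtain ⟨e', he', h⟩ := hwin w hwC hwi
            exact ⟨e', hAsub he', h⟩
        · obtain ⟨u, -, hu, -⟩ := hC.exists_adj_ne hwC w
          exact ⟨s(w, u), hoff w u hwC hu, by simp⟩) (hl e₂ (hp.edge_mem i) hf₂ hg₂)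
  refine hne (hf.eq_of_linkedOff hg ha hb (hab.mono ?_))
  rw [← draw_union]
  refine draw_mono fun e he => ?_
  by_cases h4 : e = e₁
  · exact Or.inr ⟨he, fun h5 => hp.prev_ne h3 i (h4.symm.trans h5)⟩
  · exact Or.inl ⟨he, h4⟩

/-- A complementary component of the cycle that is incident with one cycle edge is incident with
all of them. -/
lemma incEdge_of_isFaceOf_drawC (hf : IsFaceOf (emb.draw {e | e ∈ C.edges}) f)
    (hp : IsCyclicParam C p) (h3 : 3 ≤ C.length) (hi : incEdge emb f s(p i, p (i + 1)))
    (he : e ∈ C.edges) : incEdge emb f e := by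
  have key : ∀ n : ℕ, incEdge emb f s(p (i + n), p (i + n + 1)) := by
    intro n
    induction n with
    | zero => simpa using hi
    | succ n ih =>
      obtain ⟨e', he', h1, h2, h3'⟩ := exists_incEdge_ne (u := p (i + n + 1))
        (e₀ := s(p (i + n), p (i + n + 1))) (e₁ := s(p (i + n + 1), p (i + n + 1 + 1)))
        edges_subset_edgeSet hf (incVertex_of_incEdge ih (hp.adj _) (by simp)) (hp.edge_mem _)
        (hp.edge_mem _) (by simp) (by simp) (hp.edge_ne h3 (by lia) (by lia)).symm
      have := (hp.mem_edge_iff h3 he').1 h1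
      rw [add_sub_cancel_right] at this
      push_cast
      rw [← add_assoc, ← this.resolve_left h2]
      exact h3'
  obtain ⟨k, h0, -, rfl⟩ := hp.exists_window_edge (by lia) i he
  have := key k.toNat
  rwa [Int.toNat_of_nonneg h0] at this

end FacesOfH

section MinorFaces

variable {V : Type*} [Fintype V] {G : SimpleGraph V} {emb : PlaneEmbedding G} {x : V}
  {C : G.Walk x x} {p : ℤ → V} {f g h : Set (ℝ × ℝ)} {i k m : ℤ} {L M : ℕ}

/-- The face `f` is incident with the `k`-th edge of the cyclic sequence `p`. -/
def IncAt (emb : PlaneEmbedding G) (p : ℤ → V) (f : Set (ℝ × ℝ)) (k : ℤ) : Prop :=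
  incEdge emb f s(p k, p (k + 1))

omit [Fintype V] in
lemma incAt_pred : IncAt emb p f (k - 1) ↔ incEdge emb f s(p (k - 1), p k) := by
  rw [IncAt, sub_add_cancel]

omit [Fintype V] in
lemma IncAt.mono (h : IncAt emb p f k) (hfg : f ⊆ g) : IncAt emb p g k :=
  Set.Subset.trans h (closure_mono hfg)

omit [Fintype V] in
lemma IsCyclicParam.incAt_add_length (hp : IsCyclicParam C p) :
    IncAt emb p f (k + C.length) ↔ IncAt emb p f k := by
  rw [IncAt, IncAt, hp.add_length, add_right_comm, hp.add_length]

/-- The face `g` is incident with the two cycle edges at `p i` and with no other cycle edge. -/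
structure IsMidAt (emb : PlaneEmbedding G) (C : G.Walk x x) (p : ℤ → V) (g : Set (ℝ × ℝ))
    (i : ℤ) : Prop where
  prev : IncAt emb p g (i - 1)
  next : IncAt emb p g i
  dvd_of_incAt : ∀ j, IncAt emb p g j → (C.length : ℤ) ∣ j - (i - 1) ∨ (C.length : ℤ) ∣ j - i

/-- The edge `p i p (i + L)` is a chord of the cycle that is drawn in `f`. -/
structure IsChordIn (emb : PlaneEmbedding G) (C : G.Walk x x) (p : ℤ → V) (f : Set (ℝ × ℝ))
    (i : ℤ) (L : ℕ) : Prop where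
  two_le : 2 ≤ L
  add_two_le : L + 2 ≤ C.length
  adj : G.Adj (p i) (p (i + L))
  subset : emb.openArc s(p i, p (i + L)) ⊆ f

lemma MinorFaceH.adj_of_not_iff (hf : MinorFaceH emb C f) (hC : IsIsolating G C)
    (hp : IsCyclicParam C p) (h3 : 3 ≤ C.length) {v : V} (hv : v ∉ C.support)
    (hvf : incVertex emb f v) (h : ¬ (IncAt emb p f (i - 1) ↔ IncAt emb p f i)) :
    G.Adj v (p i) := by
  rw [incAt_pred] at h
  obtain ⟨w, hw, hwi, hwf⟩ := exists_offCycle_adj (hf.isFaceOf hC hp) hp h3 h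
  rwa [hf.eq_of_incVertex hv hw hvf hwf]

lemma MinorFaceH.incAt_pred_or_succ (hf : MinorFaceH emb C f)
    (hC : IsLongestIsolatingCycle G C) (hp : IsCyclicParam C p) (h3 : 3 ≤ C.length)
    (h : IncAt emb p f k) : IncAt emb p f (k - 1) ∨ IncAt emb p f (k + 1) := by
  by_contra! hcon
  obtain ⟨v, hv, hvf⟩ := hf.exists_incVertex
  refine hC.not_extendable hp hv (i := k) ?_ ?_
  · exact hf.adj_of_not_iff hC.2.1 hp h3 hv hvf fun h' => hcon.1 (h'.2 h)
  · refine hf.adj_of_not_iff hC.2.1 hp h3 hv hvf fun h' => hcon.2 (h'.1 ?_)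
    rwa [add_sub_cancel_right]

lemma MinorFaceH.exists_isMidAt (hg : MinorFaceH emb C g)
    (hC : IsLongestIsolatingCycle G C) (hp : IsCyclicParam C p) (h4 : 4 ≤ C.length)
    (h2 : numCEdges emb C g = 2) (h : IncAt emb p g k) :
    ∃ m, (m = k ∨ m = k + 1) ∧ IsMidAt emb C p g m ∧
      ∃ w, w ∉ C.support ∧ G.Adj w (p (m - 1)) ∧ G.Adj w (p (m + 1)) := by
  have h3 : 3 ≤ C.length := by lia
  obtain ⟨m, hm, hm₁, hm₂⟩ : ∃ m, (m = k ∨ m = k + 1) ∧ IncAt emb p g (m - 1) ∧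
      IncAt emb p g m := by
    rcases hg.incAt_pred_or_succ hC hp h3 h with h' | h'
    · exact ⟨k, Or.inl rfl, h', h⟩
    · exact ⟨k + 1, Or.inr rfl, by rwa [add_sub_cancel_right], h'⟩
  have hmid : IsMidAt emb C p g m := by
    refine ⟨hm₁, hm₂, fun j hj => ?_⟩
    by_contra! hcon
    have hsub : ({s(p (m - 1), p (m - 1 + 1)), s(p m, p (m + 1)), s(p j, p (j + 1))} :
        Finset (Sym2 V)) ⊆ C.edges.toFinset.filter fun e => incEdge emb g e := by
      intro e he
      simp only [Finset.mem_insert, Finset.mem_singleton] at he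
      rw [Finset.mem_filter, List.mem_toFinset]
      rcases he with rfl | rfl | rfl
      · exact ⟨hp.edge_mem _, hm₁⟩
      · exact ⟨hp.edge_mem _, hm₂⟩
      · exact ⟨hp.edge_mem _, hj⟩
    have hcard := Finset.card_le_card hsub
    rw [numCEdges] at h2
    rw [h2, Finset.card_eq_three.2 ⟨_, _, _, ?_, ?_, ?_, rfl⟩] at hcard
    · lia
    · exact hp.edge_ne h3 (by lia) (by lia)
    · exact fun h' => hcon.1 ((hp.edge_eq_iff h3).1 h'.symm)
    · exact fun h' => hcon.2 ((hp.edge_eq_iff h3).1 h'.symm)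
  have hnd : ∀ a : ℤ, 0 < a → a < C.length → ¬ (C.length : ℤ) ∣ a := fun a h0 h1 h' =>
    absurd (Int.le_of_dvd h0 h') (by lia)
  obtain ⟨v, hv, hvg⟩ := hg.exists_incVertex
  refine ⟨m, hm, hmid, v, hv, hg.adj_of_not_iff hC.2.1 hp h3 hv hvg fun h' => ?_,
    hg.adj_of_not_iff hC.2.1 hp h3 hv hvg fun h' => ?_⟩
  · rcases hmid.dvd_of_incAt _ (h'.2 hm₁) with h'' | h'' <;>
      refine hnd _ ?_ ?_ ((dvd_neg).2 h'') <;> lia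
  · rw [add_sub_cancel_right] at h'
    rcases hmid.dvd_of_incAt _ (h'.1 hm₂) with h'' | h'' <;> refine hnd _ ?_ ?_ h'' <;> lia

omit [Fintype V] in
lemma IsCyclicParam.notMem_Hgraph (hp : IsCyclicParam C p) (hL : 2 ≤ L)
    (hL' : L + 2 ≤ C.length) : s(p i, p (i + L)) ∉ (Hgraph C).edgeSet := by
  intro h
  rcases (mem_Hgraph_edgeSet.1 h).2 with h1 | ⟨v, hv, hvC⟩
  · have h3 : p (i + L) ≠ p (i + 1) := (hp.ne (by lia) (by lia)).symm
    have h4 : p (i - 1) ≠ p (i + L) := hp.ne (by lia) (by lia)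
    have h5 : p i ≠ p (i + L) := hp.ne (by lia) (by lia)
    rcases (hp.mem_edge_iff (i := i) (by lia) h1).1 (by simp) with h2 | h2 <;>
      simp only [Sym2.eq_iff] at h2 <;> grind
  · rw [Sym2.mem_iff] at hv
    rcases hv with rfl | rfl <;> exact hvC (hp.mem_supp _)

namespace IsChordIn

omit [Fintype V] in
lemma notMem_Hgraph (h : IsChordIn emb C p f i L) (hp : IsCyclicParam C p) :
    s(p i, p (i + L)) ∉ (Hgraph C).edgeSet :=
  hp.notMem_Hgraph h.two_le h.add_two_le

omit [Fintype V] in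
lemma symm (h : IsChordIn emb C p f i L) (hp : IsCyclicParam C p) :
    IsChordIn emb C p f (i + L - C.length) (C.length - L) := by
  have h1 := h.two_le
  have h2 := h.add_two_le
  have h3 : i + L - C.length + (C.length - L : ℕ) = i := by lia
  have h4 : p (i + L - C.length) = p (i + L) := (hp.eq_iff _ _).2 ⟨-1, by ring⟩
  refine ⟨by lia, by lia, ?_, ?_⟩
  · rw [h3, h4]
    exact h.adj.symm
  · rw [h3, h4, Sym2.eq_swap]
    exact h.subset

omit [Fintype V] in
lemma incVertex_of_subset (h : IsChordIn emb C p f i L)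
    (hg : emb.openArc s(p i, p (i + L)) ⊆ g) :
    incVertex emb g (p i) ∧ incVertex emb g (p (i + L)) := by
  have h1 := (arcSet_subset_closure_openArc (emb := emb) (e := s(p i, p (i + L))) h.adj).trans
    (closure_mono hg)
  exact ⟨h1 ((pos_mem_arcSet (e := s(p i, p (i + L))) h.adj).2 (by simp)),
    h1 ((pos_mem_arcSet (e := s(p i, p (i + L))) h.adj).2 (by simp))⟩

end IsChordIn

omit [Fintype V] in
/-- An edge outside `S` is drawn in one face of the drawing of `S`. -/
lemma exists_isFaceOf_openArc_subset {S : Set (Sym2 V)} {e : Sym2 V} (he : e ∈ G.edgeSet)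
    (hS : S ⊆ G.edgeSet) (heS : e ∉ S) :
    ∃ h, IsFaceOf (emb.draw S) h ∧ emb.openArc e ⊆ h := by
  obtain ⟨z, hz⟩ := openArc_nonempty (emb := emb) he
  have hd := disjoint_openArc_draw (emb := emb) he hS heS
  exact ⟨_, ⟨z, Set.disjoint_left.1 hd hz, rfl⟩,
    (isPreconnected_openArc he).subset_connectedComponentIn hz hd.subset_compl_right⟩

lemma exists_isChordIn (hG : ThreeConnected G) (hC : IsIsolating G C) (hp : IsCyclicParam C p)
    (h3 : 3 ≤ C.length) (hf : MinorFaceH emb C f) (hg : MinorFaceH emb C g) (hne : f ≠ g)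
    (hi : IsMidAt emb C p g i) (hf₁ : IncAt emb p f (i - 1)) (hf₂ : IncAt emb p f i) :
    ∃ L, IsChordIn emb C p f i L := by
  have hf' := hf.isFaceOf hC hp
  have hg' := hg.isFaceOf hC hp
  have hg₁ := hi.prev
  have hg₂ := hi.next
  rw [incAt_pred] at hf₁ hg₁
  have hsupp : ∀ v, G.Adj (p i) v → v ∈ C.support := fun v =>
    mem_support_of_adj_of_incEdge hC hf' hg' hne hp h3 hf₁ hf₂ hg₁ hg₂
  obtain ⟨t, ht, ht₁, ht₂⟩ := hG.exists_adj_ne (p i) (p (i - 1)) (p (i + 1))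
  obtain ⟨k, h0, hk, rfl⟩ := hp.exists_window (by lia) i (hsupp t ht)
  have hk₀ : k ≠ 0 := by
    rintro rfl
    simp at ht
  have hk₁ : k ≠ 1 := by
    rintro rfl
    exact ht₂ rfl
  have hk₂ : k ≠ C.length - 1 := by
    rintro rfl
    exact ht₁ ((hp.eq_iff _ _).2 ⟨1, by ring⟩)
  lift k to ℕ using h0
  have hL : 2 ≤ k := by lia
  have hL' : k + 2 ≤ C.length := by lia
  refine ⟨k, hL, hL', ht, ?_⟩
  obtain ⟨h, hh, hsub⟩ := exists_isFaceOf_openArc_subset (emb := emb) ht Hgraph_edgeSet_subset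
    (hp.notMem_Hgraph hL hL')
  have hch : IsChordIn emb C p h i k := ⟨hL, hL', ht, hsub⟩
  obtain ⟨hi₁, hi₂⟩ := hch.incVertex_of_subset hsub
  obtain ⟨e, he, hie, hne', hinc⟩ := exists_incEdge_ne Hgraph_edgeSet_subset hh hi₁
    (edges_subset_Hgraph (hp.prev_mem i)) (edges_subset_Hgraph (hp.edge_mem i)) (by simp) (by simp)
    (hp.prev_ne h3 i).symm
  have heC : e ∈ C.edges := by
    refine (mem_Hgraph_edgeSet.1 he).2.resolve_right ?_
    rintro ⟨v, hv, hvC⟩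
    have : e = s(p i, v) := (Sym2.mem_and_mem_iff (by
      rintro rfl
      exact hvC (hp.mem_supp i))).1 ⟨hie, hv⟩
    subst this
    exact hvC (hsupp v (Hgraph_edgeSet_subset he))
  obtain rfl := ((hp.mem_edge_iff h3 heC).1 hie).resolve_left hne'
  rcases faces_of_edge Hgraph_edgeSet_subset he hf' hg' hh hf₂ hg₂ hinc with rfl | rfl | rfl
  · exact absurd rfl hne
  · exact hsub
  · exfalso
    have hnd : ∀ a : ℤ, 0 < a → a < C.length → ¬ (C.length : ℤ) ∣ a := fun a h0 h1 h' =>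
      absurd (Int.le_of_dvd h0 h') (by lia)
    have key := hg.incEdge_of_incVertex hp h3 Hgraph_edgeSet_subset edges_subset_Hgraph hh
      subset_rfl hi₂ (fun e he _ => (mem_Hgraph_edgeSet.1 he).2)
    rw [← incAt_pred] at key
    rcases key with key | key <;> rcases hi.dvd_of_incAt _ key with h' | h' <;>
      refine hnd _ ?_ ?_ h' <;> lia

lemma Int.exists_not_iff_pred {P : ℤ → Prop} {a b : ℤ} (hab : a ≤ b) (h : ¬ (P a ↔ P b)) :
    ∃ t, a < t ∧ t ≤ b ∧ ¬ (P (t - 1) ↔ P t) := by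
  induction b, hab using Int.leInduction with
  | base => exact absurd Iff.rfl h
  | succ b hab ih =>
    by_cases h' : P a ↔ P b
    · exact ⟨b + 1, by lia, le_rfl, by rwa [add_sub_cancel_right, ← h']⟩
    · obtain ⟨t, h1, h2, h3⟩ := ih h'
      exact ⟨t, h1, by lia, h3⟩

/-- One of the two sides of a chord in a minor face consists of edges incident with this face. -/
lemma MinorFaceH.forall_incAt_or (hf : MinorFaceH emb C f) (hC : IsIsolating G C)
    (hp : IsCyclicParam C p) (hch : IsChordIn emb C p f i L)
    (hf₁ : IncAt emb p f (i - 1)) (hf₂ : IncAt emb p f i) :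
    (∀ j, i ≤ j → j < i + L → IncAt emb p f j) ∨
      ∀ j, i + L ≤ j → j < i + C.length → IncAt emb p f j := by
  have hL := hch.two_le
  have hL' := hch.add_two_le
  have h3 : 3 ≤ C.length := by lia
  by_contra! hcon
  obtain ⟨⟨j₁, h1, h2, hj₁⟩, ⟨j₂, h4, h5, hj₂⟩⟩ := hcon
  have hlast : IncAt emb p f (i + C.length - 1) := by
    rwa [add_sub_right_comm, hp.incAt_add_length]
  have h2' : j₂ ≠ i + C.length - 1 := by
    rintro rfl
    exact hj₂ hlast
  obtain ⟨q, hq₁, hq₂, hq⟩ : ∃ q, j₁ < q ∧ q < j₂ ∧ IncAt emb p f q := by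
    have key := hf.incEdge_of_incVertex hp h3 Hgraph_edgeSet_subset edges_subset_Hgraph
      (hf.isFaceOf hC hp) subset_rfl (hch.incVertex_of_subset hch.subset).2
      (fun e he _ => (mem_Hgraph_edgeSet.1 he).2)
    rw [← incAt_pred] at key
    rcases key with key | key
    · refine ⟨_, lt_of_le_of_ne (by lia) ?_, by lia, key⟩
      rintro rfl
      exact hj₁ key
    · refine ⟨_, by lia, lt_of_le_of_ne (by lia) ?_, key⟩
      rintro rfl
      exact hj₂ key
  obtain ⟨t₁, a₁, b₁, ht₁⟩ := Int.exists_not_iff_pred h1 (fun h => hj₁ (h.1 hf₂))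
  obtain ⟨t₂, a₂, b₂, ht₂⟩ := Int.exists_not_iff_pred hq₁.le (fun h => hj₁ (h.2 hq))
  obtain ⟨t₃, a₃, b₃, ht₃⟩ := Int.exists_not_iff_pred hq₂.le (fun h => hj₂ (h.1 hq))
  obtain ⟨t₄, a₄, b₄, ht₄⟩ := Int.exists_not_iff_pred (a := j₂) (by lia)
    (fun h => hj₂ (h.2 hlast))
  obtain ⟨v, hv, hvf⟩ := hf.exists_incVertex
  have hcard := (hC v hv).1
  have hsub : ({p t₁, p t₂, p t₃, p t₄} : Finset V) ⊆
      Finset.univ.filter fun w => G.Adj v w := by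
    intro w hw
    simp only [Finset.mem_insert, Finset.mem_singleton] at hw
    rw [Finset.mem_filter]
    refine ⟨Finset.mem_univ _, ?_⟩
    rcases hw with rfl | rfl | rfl | rfl <;> exact hf.adj_of_not_iff hC hp h3 hv hvf ‹_›
  have hle := Finset.card_le_card hsub
  have n₁₂ : p t₁ ≠ p t₂ := hp.ne (by lia) (by lia)
  have n₁₃ : p t₁ ≠ p t₃ := hp.ne (by lia) (by lia)
  have n₁₄ : p t₁ ≠ p t₄ := hp.ne (by lia) (by lia)
  have n₂₃ : p t₂ ≠ p t₃ := hp.ne (by lia) (by lia)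
  have n₂₄ : p t₂ ≠ p t₄ := hp.ne (by lia) (by lia)
  have n₃₄ : p t₃ ≠ p t₄ := hp.ne (by lia) (by lia)
  rw [hcard, Finset.card_insert_of_notMem (by simp [*]), Finset.card_insert_of_notMem (by simp [*]),
    Finset.card_pair n₃₄] at hle
  lia

end MinorFaces

section Noncrossing

variable {V : Type*} [Fintype V] {G : SimpleGraph V} {emb : PlaneEmbedding G} {x : V}
  {C : G.Walk x x} {p : ℤ → V} {f g g' h : Set (ℝ × ℝ)} {i k k' m : ℤ} {L M : ℕ}

omit [Fintype V] in
/-- A face of `H` other than the one containing a chord avoids the drawing of `H` together with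
this chord. -/
lemma IsChordIn.disjoint_draw_insert (hch : IsChordIn emb C p f i L)
    (hf : IsFaceOf (emb.draw (Hgraph C).edgeSet) f)
    (hg : IsFaceOf (emb.draw (Hgraph C).edgeSet) g) (hne : f ≠ g) (hp : IsCyclicParam C p) :
    Disjoint g (emb.draw (insert s(p i, p (i + L)) (Hgraph C).edgeSet)) := by
  rw [draw_insert, Set.disjoint_union_right]
  refine ⟨Set.disjoint_left.2 fun z hz hz' => ?_, hg.disjoint⟩
  by_cases h1 : z ∈ emb.openArc s(p i, p (i + L))
  · exact hne (hf.eq_of_linkedOff hg (hch.subset h1) hz (hg.linkedOff hz hz))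
  · obtain ⟨w, hw, rfl⟩ : z ∈ emb.pos '' {w | w ∈ s(p i, p (i + L))} := by
      by_contra h2
      exact h1 ⟨hz', h2⟩
    obtain ⟨j, rfl⟩ : ∃ j, w = p j := by
      rcases Sym2.mem_iff.1 hw with rfl | rfl <;> exact ⟨_, rfl⟩
    exact Set.disjoint_left.1 hg.disjoint hz ((pos_mem_draw Hgraph_edgeSet_subset).2
      ⟨_, edges_subset_Hgraph (hp.edge_mem j), by simp⟩)

omit [Fintype V] in
/-- The cycle formed by a chord and a segment of the cycle remains connected when one edge of the
segment is removed. -/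
lemma IsChordIn.isPreconnected_draw (hch : IsChordIn emb C p f i L) (hp : IsCyclicParam C p)
    {a b : ℕ} (hab : a + b + 1 = L) :
    IsPreconnected (emb.draw (insert s(p i, p (i + L))
      (arcEdges p i a ∪ arcEdges p (i + a + 1) b))) := by
  have hadj : s(p i, p (i + L)) ∈ G.edgeSet := hch.adj
  have h1 := hp.isPreconnected_insert_arc (emb := emb) i a
  have h2 := hp.isPreconnected_insert_arc (emb := emb) (i + a + 1) b
  have hL : i + a + 1 + b = i + (L : ℤ) := by lia
  rw [hL] at h2
  have hi : emb.pos (p i) ∈ arcSet emb s(p i, p (i + L)) := (pos_mem_arcSet hadj).2 (by simp)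
  have hiL : emb.pos (p (i + L)) ∈ arcSet emb s(p i, p (i + L)) :=
    (pos_mem_arcSet hadj).2 (by simp)
  have h3 := (h1.1.union _ (Set.mem_insert _ _) hi (isPreconnected_arcSet hadj)).union
    (emb.pos (p (i + L))) (Or.inr hiL) h2.2 h2.1
  convert h3 using 1
  rw [draw_insert, draw_union]
  have hb : emb.pos (p (i + a + 1)) ∈ arcSet emb s(p i, p (i + L)) ∪
      emb.draw (arcEdges p (i + a + 1) b) := by
    rcases Nat.eq_zero_or_pos b with rfl | hb
    · left
      convert hiL using 3
      lia
    · exact Or.inr ((pos_mem_draw (hp.arcEdges_subset_edgeSet _ _)).2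
        (exists_mem_arcEdges hb le_rfl (by lia)))
  ext z
  simp only [Set.mem_union, Set.mem_insert_iff] at hb ⊢
  grind

/-- Two chords drawn in the same minor face do not cross. -/
lemma IsChordIn.not_crossing (hch : IsChordIn emb C p f i L) (hch' : IsChordIn emb C p f m M)
    (hf : MinorFaceH emb C f) (hC : IsIsolating G C) (hp : IsCyclicParam C p)
    (hopp : ∀ j, IncAt emb p f j →
      ∃ g, IsFaceOf (emb.draw (Hgraph C).edgeSet) g ∧ f ≠ g ∧ IncAt emb p g j)
    (h₁ : i < m) (h₂ : m < i + L) (h₃ : i + L < m + M) (h₄ : m + M < i + C.length) : False := by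
  have h3 : 3 ≤ C.length := by lia
  have hf' := hf.isFaceOf hC hp
  set c₁ := s(p i, p (i + L)) with hc₁
  set c₂ := s(p m, p (m + M)) with hc₂
  have hmem : ∀ j, i < j → j < i + C.length → j ≠ i + L → p j ∉ c₁ := by
    intro j hj hj' hjL hc
    rcases Sym2.mem_iff.1 hc with hc | hc
    · exact hp.ne hj hj' hc.symm
    · rcases hjL.lt_or_gt with hjL | hjL
      · exact hp.ne hjL (by lia) hc
      · exact hp.ne hjL (by lia) hc.symm
  have hm₁ := hmem m h₁ (by lia) (by lia)
  have hm₂ := hmem (m + M) (by lia) h₄ (by lia)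
  have hc₁G : c₁ ∈ G.edgeSet := hch.adj
  have hc₂G : c₂ ∈ G.edgeSet := hch'.adj
  set S := insert c₁ (Hgraph C).edgeSet with hS
  have hSG : S ⊆ G.edgeSet := Set.insert_subset hc₁G Hgraph_edgeSet_subset
  have hc₂S : c₂ ∉ S := by
    rintro (h | h)
    · exact hm₁ (h ▸ Sym2.mem_mk_left _ _)
    · exact hch'.notMem_Hgraph hp h
  obtain ⟨h, hh, hsub⟩ := exists_isFaceOf_openArc_subset (emb := emb) hc₂G hSG hc₂S
  have hhf : h ⊆ f := by
    obtain ⟨z, hz⟩ := openArc_nonempty (emb := emb) hc₂G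
    exact fun y hy => hf'.mem_of_linkedOff (hch'.subset hz)
      ((hh.linkedOff (hsub hz) hy).mono (draw_mono (Set.subset_insert _ _)))
  have hCS : {e | e ∈ C.edges} ⊆ S := edges_subset_Hgraph.trans (Set.subset_insert _ _)
  have hinc : ∀ j, p j ∉ c₁ → incVertex emb h (p j) → IncAt emb p h (j - 1) ∨ IncAt emb p h j := by
    intro j hj hjh
    rw [incAt_pred]
    refine hf.incEdge_of_incVertex hp h3 hSG hCS hh hhf hjh fun e he hje => ?_
    rcases he with rfl | he
    · exact absurd hje hj
    · exact (mem_Hgraph_edgeSet.1 he).2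
  obtain ⟨hv₁, hv₂⟩ := hch'.incVertex_of_subset hsub
  obtain ⟨k, hk₁, hk₂, hk⟩ : ∃ k, i ≤ k ∧ k < i + L ∧ IncAt emb p h k := by
    rcases hinc m hm₁ hv₁ with h' | h'
    · exact ⟨_, by lia, by lia, h'⟩
    · exact ⟨_, by lia, by lia, h'⟩
  obtain ⟨k', hk₁', hk₂', hk'⟩ : ∃ k, i + L ≤ k ∧ k < i + C.length ∧ IncAt emb p h k := by
    rcases hinc (m + M) hm₂ hv₂ with h' | h'
    · exact ⟨_, by lia, by lia, h'⟩
    · exact ⟨_, by lia, by lia, h'⟩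
  obtain ⟨g, hg, hne, hgk⟩ := hopp k (hk.mono hhf)
  obtain ⟨g', hg', hne', hgk'⟩ := hopp k' (hk'.mono hhf)
  obtain ⟨a, ha⟩ := hh.nonempty
  obtain ⟨b, hb⟩ := hg.nonempty
  obtain ⟨b', hb'⟩ := hg'.nonempty
  have hsep : ∀ {y}, y ∈ f → ¬ LinkedOff (emb.draw {e | e ∈ C.edges}) y b := fun hy =>
    not_linkedOff_drawC hf' hg hne hp h3 (hk.mono hhf) hgk hy hb
  have hsep' : ∀ {y}, y ∈ f → ¬ LinkedOff (emb.draw {e | e ∈ C.edges}) y b' := fun hy =>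
    not_linkedOff_drawC hf' hg' hne' hp h3 (hk'.mono hhf) hgk' hy hb'
  set D := insert c₁ {e | e ∈ C.edges} with hD
  have hDS : D ⊆ S := Set.insert_subset_insert edges_subset_Hgraph
  have hDG := hDS.trans hSG
  have hlink : ∀ {j g y}, IsFaceOf (emb.draw (Hgraph C).edgeSet) g → f ≠ g → IncAt emb p h j →
      IncAt emb p g j → y ∈ g → LinkedOff (emb.draw (D \ {s(p j, p (j + 1))})) a y := by
    intro j g y hg hne hhj hgj hy
    have hsub : D \ {s(p j, p (j + 1))} ⊆ S := Set.sdiff_subset.trans hDS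
    exact linkedOff_diff_of_incEdge (hsub.trans hSG) (hp.adj j) (by simp) hh.isPreconnected
      hg.isPreconnected (hh.disjoint.mono_right (draw_mono hsub))
      ((hch.disjoint_draw_insert hf' hg hne hp).mono_right (draw_mono hsub)) hhj hgj ha hy
  have hbb : LinkedOff (emb.draw D) b b' := by
    have hface : ∀ {z g}, IsFaceOf (emb.draw (Hgraph C).edgeSet) g → z ∈ g →
        IsFaceOf (emb.draw {e | e ∈ C.edges})
          (connectedComponentIn (emb.draw {e | e ∈ C.edges})ᶜ z) ∧
        g ⊆ connectedComponentIn (emb.draw {e | e ∈ C.edges})ᶜ z := by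
      intro z g hg hz
      have hd := hg.disjoint.mono_right (draw_mono (emb := emb) (edges_subset_Hgraph (C := C)))
      exact ⟨⟨z, Set.disjoint_left.1 hd hz, rfl⟩,
        hg.isPreconnected.subset_connectedComponentIn hz hd.subset_compl_right⟩
    obtain ⟨ha₁, ha₂⟩ := hface hf' (hhf ha)
    obtain ⟨hb₁, hb₂⟩ := hface hg hb
    obtain ⟨hb₁', hb₂'⟩ := hface hg' hb'
    have hcase := faces_of_edge edges_subset_edgeSet (hp.edge_mem k) ha₁ hb₁ hb₁'
      (hk.mono (hhf.trans ha₂)) (hgk.mono hb₂)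
      (incEdge_of_isFaceOf_drawC hb₁' hp h3 (hgk'.mono hb₂') (hp.edge_mem k))
    have heq := (hcase.resolve_left fun h' =>
      hsep (hhf ha) (ha₁.linkedOff (ha₂ (hhf ha)) (h' ▸ hb₂ hb))).resolve_left fun h' =>
      hsep' (hhf ha) (ha₁.linkedOff (ha₂ (hhf ha)) (h' ▸ hb₂' hb'))
    refine ⟨_, hb₁.isPreconnected, ?_, hb₂ hb, heq ▸ hb₂' hb'⟩
    refine (Set.disjoint_left.2 fun z hz hz' => ?_ : Disjoint _ _).subset_compl_right
    rw [hD, draw_insert] at hz'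
    rcases hz' with hz' | hz'
    · by_cases h1 : z ∈ emb.openArc c₁
      · exact hsep (hch.subset h1) (hb₁.linkedOff hz (hb₂ hb))
      · obtain ⟨w, hw, rfl⟩ : z ∈ emb.pos '' {w | w ∈ c₁} := by
          by_contra h2
          exact h1 ⟨hz', h2⟩
        obtain ⟨j, rfl⟩ : ∃ j, w = p j := by
          rcases Sym2.mem_iff.1 hw with rfl | rfl <;> exact ⟨_, rfl⟩
        exact Set.disjoint_left.1 hb₁.disjoint hz ((pos_mem_draw edges_subset_edgeSet).2
          ⟨_, hp.edge_mem j, by simp⟩)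
    · exact Set.disjoint_left.1 hb₁.disjoint hz hz'
  set T := insert c₁ (arcEdges p i L) with hT
  have hTD : T ⊆ D := Set.insert_subset_insert (hp.arcEdges_subset _ _)
  have hcC : ∀ j, c₁ ≠ s(p j, p (j + 1)) := fun j h' =>
    hch.notMem_Hgraph hp (hc₁.symm.trans h' ▸ edges_subset_Hgraph (hp.edge_mem j))
  have hab : LinkedOff (emb.draw T) a b := by
    refine ((hlink hg' hne' hk' hgk' hb').mono (draw_mono ?_)).trans
      (hbb.symm.mono (draw_mono hTD))
    intro e he
    refine ⟨hTD he, ?_⟩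
    rcases he with rfl | he
    · exact hcC k'
    · obtain ⟨j, hj₁, hj₂, rfl⟩ := mem_arcEdges.1 he
      exact hp.edge_ne h3 (by lia) (by lia)
  obtain ⟨n, rfl⟩ := Int.exists_add_of_le hk₁
  obtain ⟨n', hn'⟩ : ∃ n' : ℕ, n + n' + 1 = L := ⟨L - n - 1, by lia⟩
  have hinter : T ∩ (D \ {s(p (i + n), p (i + n + 1))}) =
      insert c₁ (arcEdges p i n ∪ arcEdges p (i + n + 1) n') := by
    rw [← Set.inter_sdiff_assoc, Set.inter_eq_left.2 hTD]
    ext e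
    simp only [Set.mem_sdiff, Set.mem_singleton_iff, hT, Set.mem_insert_iff, Set.mem_union]
    constructor
    · rintro ⟨rfl | he, hne⟩
      · exact Or.inl rfl
      · right
        obtain ⟨j, hj₁, hj₂, rfl⟩ := mem_arcEdges.1 he
        have : j ≠ i + n := by
          rintro rfl
          exact hne rfl
        rw [mem_arcEdges, mem_arcEdges]
        rcases this.lt_or_gt with h' | h'
        · exact Or.inl ⟨j, by lia, by lia, rfl⟩
        · exact Or.inr ⟨j, by lia, by lia, rfl⟩
    · rintro (rfl | he | he)
      · exact ⟨Or.inl rfl, hcC _⟩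
      · obtain ⟨j, hj₁, hj₂, rfl⟩ := mem_arcEdges.1 he
        exact ⟨Or.inr (mem_arcEdges.2 ⟨j, by lia, by lia, rfl⟩),
          hp.edge_ne h3 (by lia) (by lia)⟩
      · obtain ⟨j, hj₁, hj₂, rfl⟩ := mem_arcEdges.1 he
        exact ⟨Or.inr (mem_arcEdges.2 ⟨j, by lia, by lia, rfl⟩),
          (hp.edge_ne h3 (by lia) (by lia)).symm⟩
  have hfinal := hab.union (isCompact_draw (hTD.trans hDG))
    (isCompact_draw (Set.sdiff_subset.trans hDG)) (by
      rw [draw_inter (hTD.trans hDG) (Set.sdiff_subset.trans hDG), hinter]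
      · exact hch.isPreconnected_draw hp hn'
      · rintro w ⟨e, he, hwe⟩ -
        rw [hinter]
        rcases he with rfl | he
        · exact ⟨_, Or.inl rfl, hwe⟩
        · obtain ⟨j, hj₁, hj₂, rfl⟩ := mem_arcEdges.1 he
          obtain ⟨l, hl₁, hl₂, rfl⟩ : ∃ l, i ≤ l ∧ l ≤ i + L ∧ w = p l := by
            rcases Sym2.mem_iff.1 hwe with rfl | rfl
            · exact ⟨j, by lia, by lia, rfl⟩
            · exact ⟨j + 1, by lia, by lia, rfl⟩
          by_cases h1 : l = i
          · exact ⟨c₁, Or.inl rfl, by simp [h1, hc₁]⟩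
          by_cases h2 : l = i + L
          · exact ⟨c₁, Or.inl rfl, by simp [h2, hc₁]⟩
          rcases le_or_gt l (i + n) with h' | h'
          · obtain ⟨e, he, hle⟩ := exists_mem_arcEdges (p := p) (n := n) (by lia) hl₁ h'
            exact ⟨e, Or.inr (Or.inl he), hle⟩
          · obtain ⟨e, he, hle⟩ := exists_mem_arcEdges (p := p) (i := i + n + 1) (n := n')
              (j := l) (by lia) (by lia) (by lia)
            exact ⟨e, Or.inr (Or.inr he), hle⟩) (hlink hg hne hk hgk hb)
  refine hsep (hhf ha) (hfinal.mono ?_)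
  rw [← draw_union]
  refine draw_mono fun e he => ?_
  by_cases h' : e = s(p (i + n), p (i + n + 1))
  · exact Or.inl (Or.inr (mem_arcEdges.2 ⟨i + n, by lia, by lia, h'.symm⟩))
  · exact Or.inr ⟨Or.inr he, h'⟩

end Noncrossing

section Surrounded

variable {V : Type*} [Fintype V] {G : SimpleGraph V} {emb : PlaneEmbedding G} {x : V}
  {C : G.Walk x x} {p : ℤ → V} {f : Set (ℝ × ℝ)}

/-- A minor face with a chord that cuts off only edges of this face has a cycle edge that is not
incident with another minor 2-face. -/
lemma IsChordIn.exists_not_twoFace (hG : ThreeConnected G) (hC : IsLongestIsolatingCycle G C)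
    (h8 : 8 ≤ C.length) (hp : IsCyclicParam C p) (hf : MinorFaceH emb C f)
    (hopp : ∀ j, IncAt emb p f j →
      ∃ g, MinorFaceH emb C g ∧ f ≠ g ∧ numCEdges emb C g = 2 ∧ IncAt emb p g j)
    (L : ℕ) {i : ℤ} (hch : IsChordIn emb C p f i L)
    (hinc : ∀ j, i ≤ j → j < i + L → IncAt emb p f j) : False := by
  induction L using Nat.strong_induction_on generalizing i with
  | _ L ih =>
  have h2 := hch.two_le
  have hno : ∀ m g, i < m → m < i + L → MinorFaceH emb C g → f ≠ g → IsMidAt emb C p g m →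
      False := by
    intro m g h₁ h₂ hg hne hm
    obtain ⟨M, hM⟩ := exists_isChordIn hG hC.2.1 hp (by lia) hf hg hne hm
      (hinc _ (by lia) (by lia)) (hinc _ (by lia) (by lia))
    have hM₁ := hM.two_le
    have hM₂ := hM.add_two_le
    rcases le_or_gt (m + M) (i + L) with h₃ | h₃
    · exact ih M (by lia) hM fun j hj hj' => hinc j (by lia) (by lia)
    rcases lt_or_ge (m + M) (i + C.length) with h₄ | h₄
    · refine hch.not_crossing hM hf hC.2.1 hp (fun j hj => ?_) h₁ h₂ h₃ h₄
      obtain ⟨g, hg, hne, -, hgj⟩ := hopp j hj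
      exact ⟨g, hg.isFaceOf hC.2.1 hp, hne, hgj⟩
    · exact ih (C.length - M) (by lia) (hM.symm hp) fun j hj hj' => hinc j (by lia) (by lia)
  rcases h2.eq_or_lt with rfl | h2
  · obtain ⟨g, hg, hne, hg2, hgi⟩ := hopp i (hinc i le_rfl (by lia))
    obtain ⟨m, rfl | rfl, hm, w, hw, hw₁, hw₂⟩ := hg.exists_isMidAt hC hp (by lia) hg2 hgi
    · exact hC.not_bypass h8 hp hw hw₁ hw₂ hch.adj
    · exact hno _ g (by lia) (by lia) hg hne hm
  · obtain ⟨g, hg, hne, hg2, hgi⟩ := hopp (i + 1) (hinc _ (by lia) (by lia))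
    obtain ⟨m, hm', hm, -⟩ := hg.exists_isMidAt hC hp (by lia) hg2 hgi
    exact hno m g (by lia) (by lia) hg hne hm

/-- A minor face with at least four cycle edges has a cycle edge that is not incident with another
minor 2-face. -/
lemma MinorFaceH.exists_not_twoFace (hG : ThreeConnected G) (hC : IsLongestIsolatingCycle G C)
    (h8 : 8 ≤ C.length) (hp : IsCyclicParam C p) (hf : MinorFaceH emb C f)
    (hf4 : 4 ≤ numCEdges emb C f) :
    ∃ e ∈ C.edges, incEdge emb f e ∧
      ∀ g, MinorFaceH emb C g → numCEdges emb C g = 2 → incEdge emb g e → f = g := by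
  by_contra! hcon
  have hopp : ∀ j, IncAt emb p f j →
      ∃ g, MinorFaceH emb C g ∧ f ≠ g ∧ numCEdges emb C g = 2 ∧ IncAt emb p g j := by
    intro j hj
    obtain ⟨g, h1, h2, h3, h4⟩ := hcon _ (hp.edge_mem j) hj
    exact ⟨g, h1, h4, h2, h3⟩
  have hmid : ∀ e ∈ C.edges.toFinset.filter fun e => incEdge emb f e,
      ∃ m, ((s(p (m - 1), p m) = e ∧ ¬ IncAt emb p f m) ∨
        (s(p m, p (m + 1)) = e ∧ ¬ IncAt emb p f (m - 1))) := by
    intro e he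
    rw [Finset.mem_filter, List.mem_toFinset] at he
    obtain ⟨k, rfl⟩ := (hp.mem_edges e).1 he.1
    obtain ⟨g, hg, hne, hg2, hgk⟩ := hopp k he.2
    obtain ⟨m, hmk, hm, -⟩ := hg.exists_isMidAt hC hp (by lia) hg2 hgk
    have hnot : ¬ (IncAt emb p f (m - 1) ∧ IncAt emb p f m) := by
      rintro ⟨h1, h2⟩
      obtain ⟨M, hM⟩ := exists_isChordIn hG hC.2.1 hp (by lia) hf hg hne hm h1 h2
      have hM₁ := hM.two_le
      have hM₂ := hM.add_two_le
      rcases hf.forall_incAt_or hC.2.1 hp hM h1 h2 with h' | h'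
      · exact hM.exists_not_twoFace hG hC h8 hp hf hopp M h'
      · refine (hM.symm hp).exists_not_twoFace hG hC h8 hp hf hopp _ fun j hj hj' => ?_
        rw [← hp.incAt_add_length]
        exact h' _ (by lia) (by lia)
    rcases hmk with rfl | rfl
    · exact ⟨m, Or.inr ⟨rfl, fun h => hnot ⟨h, he.2⟩⟩⟩
    · refine ⟨k + 1, Or.inl ⟨by rw [add_sub_cancel_right], fun h => hnot ⟨?_, h⟩⟩⟩
      rw [add_sub_cancel_right]
      exact he.2
  choose! m hm using hmid
  obtain ⟨v, hv, hvf⟩ := hf.exists_incVertex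
  have hinc : ∀ e ∈ C.edges.toFinset.filter fun e => incEdge emb f e, incEdge emb f e :=
    fun e he => (Finset.mem_filter.1 he).2
  have hmaps : ∀ e ∈ C.edges.toFinset.filter fun e => incEdge emb f e,
      p (m e) ∈ Finset.univ.filter fun w => G.Adj v w := by
    intro e he
    rw [Finset.mem_filter]
    refine ⟨Finset.mem_univ _, hf.adj_of_not_iff hC.2.1 hp (by lia) hv hvf fun h => ?_⟩
    have hi := hinc e he
    rcases hm e he with ⟨h1, h2⟩ | ⟨h1, h2⟩
    · exact h2 (h.1 (by rw [incAt_pred, h1]; exact hi))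
    · exact h2 (h.2 (by rw [IncAt, h1]; exact hi))
  have hcard := Finset.card_le_card_of_injOn (fun e => p (m e)) hmaps (by
    intro e he e' he' h
    have h : p (m e) = p (m e') := h
    have hd := (hp.eq_iff _ _).1 h
    have h₁ : p (m e - 1) = p (m e' - 1) := (hp.eq_iff _ _).2 (by simpa using hd)
    have h₂ : p (m e + 1) = p (m e' + 1) := (hp.eq_iff _ _).2 (by simpa using hd)
    have hi := hinc e he
    have hi' := hinc e' he'
    have hm₁ := hm e he
    have hm₂ := hm e' he'
    rw [incAt_pred, IncAt, h, h₁, h₂] at hm₁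
    rw [incAt_pred, IncAt] at hm₂
    grind)
  rw [(hC.2.1 v hv).1] at hcard
  rw [numCEdges] at hf4
  lia

end Surrounded

section Discharging

variable {V : Type*} [Fintype V] {G : SimpleGraph V} {emb : PlaneEmbedding G} {x : V}
  {C : G.Walk x x} {p : ℤ → V} {f f' : Set (ℝ × ℝ)}

omit [Fintype V] in
lemma mEdges_comm : mEdges emb C f f' = mEdges emb C f' f := by
  simp only [mEdges, and_comm]

lemma sendWeight_nonneg : 0 ≤ sendWeight emb C f f' := by
  rw [sendWeight]
  positivity

/-- A minor face has at least two edges in common with a 3-face that is opposite with respect to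
the middle edge of the latter. -/
lemma MinorFaceH.two_le_mEdges (hf : MinorFaceH emb C f) (hC : IsLongestIsolatingCycle G C)
    (hp : IsCyclicParam C p) (h3 : 3 ≤ C.length) (hf' : numCEdges emb C f' = 3) {e : Sym2 V}
    (he : IsMiddleCEdge emb C f' e) (hfe : incEdge emb f e) : 2 ≤ mEdges emb C f f' := by
  obtain ⟨heC, hf'e, hmid⟩ := he
  obtain ⟨k, rfl⟩ := (hp.mem_edges e).1 heC
  have hsub : C.edges.toFinset.filter (fun e => incEdge emb f' e) ⊆
      {s(p (k - 1), p (k - 1 + 1)), s(p k, p (k + 1)), s(p (k + 1), p (k + 1 + 1))} := by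
    intro e he
    rw [Finset.mem_filter, List.mem_toFinset] at he
    simp only [Finset.mem_insert, Finset.mem_singleton]
    by_cases hne : e = s(p k, p (k + 1))
    · exact Or.inr (Or.inl hne)
    · obtain ⟨v, hv, hve⟩ := hmid e he.1 he.2 hne
      rcases Sym2.mem_iff.1 hv with rfl | rfl
      · have := (hp.mem_edge_iff h3 he.1).1 hve
        rw [sub_add_cancel]
        tauto
      · have := (hp.mem_edge_iff h3 he.1).1 hve
        rw [add_sub_cancel_right] at this
        tauto
  have heq := Finset.eq_of_subset_of_card_le hsub (by
    rw [numCEdges] at hf'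
    rw [hf']
    exact Finset.card_le_three)
  have hall : ∀ j, j = k - 1 ∨ j = k + 1 → IncAt emb p f j → 2 ≤ mEdges emb C f f' := by
    intro j hj hfj
    have hmem : s(p j, p (j + 1)) ∈ C.edges.toFinset.filter (fun e => incEdge emb f' e) := by
      rw [heq]
      rcases hj with rfl | rfl <;> simp
    have hne : s(p k, p (k + 1)) ≠ s(p j, p (j + 1)) := by
      rcases hj with rfl | rfl
      · exact (hp.edge_ne h3 (by lia) (by lia)).symm
      · exact hp.edge_ne h3 (by lia) (by lia)
    rw [mEdges, ← Finset.card_pair hne]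
    refine Finset.card_le_card fun e he => ?_
    rw [Finset.mem_filter] at hmem ⊢
    rcases Finset.mem_insert.1 he with rfl | he
    · exact ⟨List.mem_toFinset.2 heC, hfe, hf'e⟩
    · rw [Finset.mem_singleton.1 he]
      exact ⟨hmem.1, hfj, hmem.2⟩
  rcases hf.incAt_pred_or_succ hC hp h3 (k := k) hfe with h | h
  · exact hall _ (Or.inl rfl) h
  · exact hall _ (Or.inr rfl) h

/-- Bounds for the weight that a minor face sends to another face. -/
lemma MinorFaceH.sendWeight_le (hf : MinorFaceH emb C f) (hC : IsLongestIsolatingCycle G C)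
    (hp : IsCyclicParam C p) (h3 : 3 ≤ C.length) (h0 : sendWeight emb C f f' ≠ 0) :
    MinorFaceH emb C f' ∧ f ≠ f' ∧
      sendWeight emb C f f' ≤ 2 / 3 * mEdges emb C f f' ∧
      (numCEdges emb C f' ≠ 2 →
        sendWeight emb C f f' ≤ 2 / 3 * mEdges emb C f f' - 1 / 3) := by
  have hmaj : ¬ MajorFaceH emb C f := fun h => h.2 hf
  have hf' : MinorFaceH emb C f' := by
    by_contra hf'
    exact h0 (by simp [sendWeight, hf'])
  have hne : f ≠ f' := by
    rintro rfl
    exact h0 (by simp [sendWeight, OppositeFaces])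
  refine ⟨hf', hne, ?_⟩
  have h2' : numCEdges emb C f' ≠ 2 →
      sendWeight emb C f f' ≤ 2 / 3 * mEdges emb C f f' - 1 / 3 := by
    intro h2
    by_cases hj3 : numCEdges emb C f' = 3
    · have hs : sendWeight emb C f f' = if f ≠ f' ∧
          ∃ e, IsMiddleCEdge emb C f' e ∧ incEdge emb f e then 1 else 0 := by
        simp [sendWeight, hmaj, hf, hf', hj3]
      rw [hs] at h0 ⊢
      split_ifs at h0 ⊢ with hcond
      swap
      · exact absurd rfl h0
      obtain ⟨-, e, he, hfe⟩ := hcond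
      have hm : (2 : ℚ) ≤ mEdges emb C f f' := by
        exact_mod_cast hf.two_le_mEdges hC hp h3 hj3 he hfe
      linarith
    by_cases hj4 : numCEdges emb C f' = 4
    · rw [sendWeight] at h0 ⊢
      simp only [hmaj, hj4, false_and, and_false, if_false, zero_add, add_zero,
        Nat.reduceEqDiff] at h0 ⊢
      split_ifs at h0 ⊢ with hcond
      swap
      · exact absurd rfl h0
      rw [mEdges_comm, hcond.2.2.2.2.2.1]
      norm_num
    · rw [sendWeight] at h0 ⊢
      simp only [hmaj, h2, hj3, hj4, false_and, and_false, if_false, zero_add, add_zero] at h0 ⊢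
      split_ifs at h0 ⊢ with hcond
      swap
      · exact absurd rfl h0
      rw [mEdges_comm, hcond.2.2.2.2.2.1]
      norm_num
  refine ⟨?_, h2'⟩
  by_cases h2 : numCEdges emb C f' = 2
  · rw [sendWeight] at h0 ⊢
    simp only [hmaj, h2, false_and, and_false, if_false, zero_add, add_zero,
      Nat.reduceEqDiff] at h0 ⊢
    split_ifs at h0 ⊢
    · exact le_rfl
    · exact absurd rfl h0
  · exact (h2' h2).trans (by linarith)

/-- The total weight sent by a minor face with at least four cycle edges. -/
lemma MinorFaceH.finsum_sendWeight_le (hG : ThreeConnected G)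
    (hC : IsLongestIsolatingCycle G C) (h8 : 8 ≤ C.length) (hf : MinorFaceH emb C f)
    (hf4 : 4 ≤ numCEdges emb C f) :
    ∑ᶠ f', sendWeight emb C f f' ≤ 2 / 3 * (numCEdges emb C f : ℚ) - 1 / 3 := by
  obtain ⟨p, hp⟩ := exists_isCyclicParam hC.1
  have h3 : 3 ≤ C.length := by lia
  have hj : (4 : ℚ) ≤ numCEdges emb C f := by exact_mod_cast hf4
  by_cases hfin : (Function.support fun f' => sendWeight emb C f f').Finite
  swap
  · rw [finsum_of_infinite_support hfin]
    linarith
  rw [finsum_eq_sum _ hfin]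
  set s := hfin.toFinset with hs
  have hsend : ∀ f' ∈ s, _ := fun f' hf' =>
    hf.sendWeight_le hC hp h3 (hfin.mem_toFinset.1 hf')
  set E := C.edges.toFinset.filter (fun e => incEdge emb f e) with hE
  let E' : Set (ℝ × ℝ) → Finset (Sym2 V) := fun f' =>
    C.edges.toFinset.filter fun e => incEdge emb f e ∧ incEdge emb f' e
  have hdisj : (s : Set (Set (ℝ × ℝ))).PairwiseDisjoint E' := by
    intro g hg g' hg' hne
    refine Finset.disjoint_left.2 fun e he he' => ?_
    simp only [E', Finset.mem_filter, List.mem_toFinset] at he he'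
    obtain ⟨hg₁, hg₂, -⟩ := hsend g hg
    obtain ⟨hg₁', hg₂', -⟩ := hsend g' hg'
    rcases faces_of_edge Hgraph_edgeSet_subset (edges_subset_Hgraph he.1) (hf.isFaceOf hC.2.1 hp)
      (hg₁.isFaceOf hC.2.1 hp) (hg₁'.isFaceOf hC.2.1 hp) he.2.1 he.2.2 he'.2.2 with h | h | h
    · exact hg₂ h
    · exact hg₂' h
    · exact hne h
  have hsum : ∑ f' ∈ s, mEdges emb C f f' = (s.biUnion E').card := (Finset.card_biUnion hdisj).symm
  have hsub : s.biUnion E' ⊆ E := by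
    refine Finset.biUnion_subset.2 fun g _ e he => ?_
    simp only [E', hE, Finset.mem_filter] at he ⊢
    exact ⟨he.1, he.2.1⟩
  have hle : ∑ f' ∈ s, sendWeight emb C f f' ≤ 2 / 3 * ((∑ f' ∈ s, mEdges emb C f f' : ℕ) : ℚ) := by
    rw [Nat.cast_sum, Finset.mul_sum]
    exact Finset.sum_le_sum fun g hg => (hsend g hg).2.2.1
  by_cases htwo : ∀ g ∈ s, numCEdges emb C g = 2
  · obtain ⟨e, heC, hfe, he⟩ := hf.exists_not_twoFace hG hC h8 hp hf4
    have hlt : (s.biUnion E').card < numCEdges emb C f := by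
      refine Finset.card_lt_card (hsub.ssubset_of_mem_notMem (a := e) ?_ ?_)
      · exact Finset.mem_filter.2 ⟨List.mem_toFinset.2 heC, hfe⟩
      · intro h
        obtain ⟨g, hg, heg⟩ := Finset.mem_biUnion.1 h
        exact (hsend g hg).2.1 (he g (hsend g hg).1 (htwo g hg) (Finset.mem_filter.1 heg).2.2)
    rw [← hsum] at hlt
    have hlt' : ((∑ f' ∈ s, mEdges emb C f f' : ℕ) : ℚ) + 1 ≤ numCEdges emb C f := by
      exact_mod_cast hlt
    linarith
  · push Not at htwo
    obtain ⟨g, hg, hg2⟩ := htwo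
    have hcard : (s.biUnion E').card ≤ numCEdges emb C f := Finset.card_le_card hsub
    rw [← hsum] at hcard
    have hcard' : ((∑ f' ∈ s, mEdges emb C f f' : ℕ) : ℚ) ≤ numCEdges emb C f := by
      exact_mod_cast hcard
    have hle' : ∑ f' ∈ s, sendWeight emb C f f' ≤
        2 / 3 * ((∑ f' ∈ s, mEdges emb C f f' : ℕ) : ℚ) - 1 / 3 := by
      rw [Nat.cast_sum, Finset.mul_sum, ← Finset.add_sum_erase _ _ hg,
        ← Finset.add_sum_erase s (fun f' => 2 / 3 * (mEdges emb C f f' : ℚ)) hg, add_sub_right_comm]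
      exact add_le_add ((hsend g hg).2.2.2 hg2)
        (Finset.sum_le_sum fun g hg => (hsend g (Finset.mem_of_mem_erase hg)).2.2.1)
    linarith

end Discharging

/-- After discharging by rules R1–R5, every minor `j`-face of `H` with `j ≥ 9` has
weight `≥ 10/3`. -/
theorem stmt15_minor_big_face
    {V : Type*} [Fintype V] {G : SimpleGraph V}
    (hn : 11 ≤ Fintype.card V) (h4 : EssentiallyFourConnected G)
    (emb : PlaneEmbedding G) {x : V} (C : G.Walk x x)
    (hC : IsLongestIsolatingCycle G C) (hc : 8 ≤ C.length)
    (hVm : (Vminus emb C).Nonempty) (hVp : (Vplus emb C).Nonempty) :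
    ∀ f : Set (ℝ × ℝ), MinorFaceH emb C f → 9 ≤ numCEdges emb C f →
      (10 : ℚ) / 3 ≤ wFace emb C f := by
  intro f hf h9
  have h1 := hf.finsum_sendWeight_le h4.1 hC hc (by lia)
  have h2 : 0 ≤ ∑ᶠ f', sendWeight emb C f' f := finsum_nonneg fun _ => sendWeight_nonneg
  have h3 : (9 : ℚ) ≤ numCEdges emb C f := by exact_mod_cast h9
  rw [wFace]
  linarith

end
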